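/- Let Δ : ℕ → ℕ and, for each n, let H_n be a simple graph on n vertices with maximum degree at most Δ(n). Then there exists a function f : ℕ → ℝ with f(D) ≥ 0 for all D and f(D) → 0 as D → ∞ (f depends only on the degree bound, not on n or the graphs), and for each n a Builder strategy in the semirandom star process on vertex set [n], such that the probability that Builder's graph after ⌈(1 + f(Δ(n))) · Δ(n) · n / 2⌉ rounds contains a copy of H_n tends to 1 as n → ∞. -/

import Mathlib

open Filter

/-- A Builder strategy in the semirandom star process on `Fin n`: given the list of
previously offered vertices (earliest first) and the currently offered vertex `u`,
Builder either chooses some vertex `w` (claiming the edge `{u, w}`, provided `w ≠ u`;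
a choice `w = u` yields no edge, exactly as the choice `none`). -/
def StarStrategy (n : ℕ) : Type := List (Fin n) → Fin n → Option (Fin n)

/-- The (at most one) edge claimed in a single round in which `u` is offered,
after the history `hist` of previous offers. -/
def starStep {n : ℕ} (σ : StarStrategy n) (hist : List (Fin n)) (u : Fin n) :
    SimpleGraph (Fin n) :=
  match σ hist u with
  | none => ⊥
  | some w => SimpleGraph.fromEdgeSet {s(u, w)}

/-- Builder's graph resulting from playing strategy `σ` on a given list of offers,
where `hist` records the offers made in earlier rounds. -/
def starBuildAux {n : ℕ} (σ : StarStrategy n) :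
    List (Fin n) → List (Fin n) → SimpleGraph (Fin n)
  | _, [] => ⊥
  | hist, u :: rest => starStep σ hist u ⊔ starBuildAux σ (hist ++ [u]) rest

/-- Builder's graph after playing strategy `σ` on the list `offers` of offered vertices. -/
def starBuild {n : ℕ} (σ : StarStrategy n) (offers : List (Fin n)) : SimpleGraph (Fin n) :=
  starBuildAux σ [] offers

/-- `G` contains a copy of `H`. -/
def ContainsCopy {n : ℕ} (G H : SimpleGraph (Fin n)) : Prop :=
  ∃ φ : Fin n → Fin n, Function.Injective φ ∧ ∀ u v : Fin n, H.Adj u v → G.Adj (φ u) (φ v)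

/-- The probability that after `t` rounds of the semirandom star process (offers being
i.i.d. uniform vertices of `Fin n`), Builder's graph, playing `σ`, contains a copy of `H`. -/
noncomputable def starProb (n t : ℕ) (σ : StarStrategy n) (H : SimpleGraph (Fin n)) : ℝ :=
  (Nat.card {ω : Fin t → Fin n // ContainsCopy (starBuild σ (List.ofFn ω)) H} : ℝ) /
    (n : ℝ) ^ t

/-- The expectation of `Q` over a uniformly random list of `t` offers. -/
noncomputable def offerMean {n : ℕ} : ℕ → (List (Fin n) → ℝ) → ℝ
  | 0, Q => Q []
  | t + 1, Q => (∑ u, offerMean t (fun l => Q (u :: l))) / n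

open Classical in
/-- The probability of the event `E` for a uniformly random list of `t` offers. -/
noncomputable def offerProb {n : ℕ} (t : ℕ) (E : List (Fin n) → Prop) : ℝ :=
  offerMean t (fun l => if E l then 1 else 0)

section Mean

variable {n : ℕ}

theorem offerMean_mono {t : ℕ} {Q R : List (Fin n) → ℝ}
    (h : ∀ l, l.length = t → Q l ≤ R l) : offerMean t Q ≤ offerMean t R := by
  induction t generalizing Q R with
  | zero => exact h [] rfl
  | succ t ih =>
    simp only [offerMean]
    gcongr
    exact ih fun l hl => h _ (by simp [hl])

theorem offerMean_add (t : ℕ) (Q R : List (Fin n) → ℝ) :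
    offerMean t (fun l => Q l + R l) = offerMean t Q + offerMean t R := by
  induction t generalizing Q R with
  | zero => rfl
  | succ t ih => simp only [offerMean, ih, Finset.sum_add_distrib, add_div]

theorem offerMean_const_mul (t : ℕ) (c : ℝ) (Q : List (Fin n) → ℝ) :
    offerMean t (fun l => c * Q l) = c * offerMean t Q := by
  induction t generalizing Q with
  | zero => rfl
  | succ t ih => simp only [offerMean, ih, ← Finset.mul_sum, mul_div_assoc]

theorem offerMean_const (hn : 0 < n) (t : ℕ) (c : ℝ) :
    offerMean t (fun _ : List (Fin n) => c) = c := by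
  induction t with
  | zero => rfl
  | succ t ih =>
    simp only [offerMean, ih, Finset.sum_const, Finset.card_univ, Fintype.card_fin, nsmul_eq_mul]
    field_simp

theorem offerMean_zero (t : ℕ) : offerMean t (fun _ : List (Fin n) => 0) = 0 := by
  simpa using offerMean_const_mul t 0 (fun _ : List (Fin n) => 0)

theorem offerMean_sum {ι : Type*} (s : Finset ι) (t : ℕ) (Q : ι → List (Fin n) → ℝ) :
    offerMean t (fun l => ∑ i ∈ s, Q i l) = ∑ i ∈ s, offerMean t (Q i) := by
  classical
  induction s using Finset.induction_on with
  | empty => simpa using offerMean_zero t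
  | insert a s ha ih => simp only [Finset.sum_insert ha, offerMean_add, ih]

theorem offerMean_append (s t : ℕ) (Q : List (Fin n) → ℝ) :
    offerMean (s + t) Q = offerMean s (fun l => offerMean t (fun l' => Q (l ++ l'))) := by
  induction s generalizing Q with
  | zero => simp [offerMean]
  | succ s ih =>
    rw [Nat.succ_add]
    simp only [offerMean, ih, List.cons_append]

theorem offerProb_mono {t : ℕ} {E F : List (Fin n) → Prop}
    (h : ∀ l, l.length = t → E l → F l) : offerProb t E ≤ offerProb t F := by
  refine offerMean_mono fun l hl => ?_
  by_cases hE : E l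
  · simp [hE, h l hl hE]
  · simp only [hE, if_false]
    split_ifs <;> norm_num

theorem offerMean_nonneg {t : ℕ} {Q : List (Fin n) → ℝ} (h : ∀ l, 0 ≤ Q l) :
    0 ≤ offerMean t Q := by
  rw [← offerMean_zero (n := n) t]
  exact offerMean_mono fun l _ => h l

open Classical in
theorem offerProb_exists_le {ι : Type*} (s : Finset ι) (t : ℕ) (E : ι → List (Fin n) → Prop) :
    offerProb t (fun l => ∃ i ∈ s, E i l) ≤ ∑ i ∈ s, offerProb t (E i) := by
  unfold offerProb
  rw [← offerMean_sum]
  refine offerMean_mono fun l _ => ?_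
  split_ifs with h
  · obtain ⟨i, hi, hE⟩ := h
    have := Finset.single_le_sum (f := fun i => if E i l then (1 : ℝ) else 0)
      (fun j _ => by split_ifs <;> norm_num) hi
    simpa [hE] using this
  · exact Finset.sum_nonneg fun j _ => by split_ifs <;> norm_num

theorem offerProb_or_le (t : ℕ) (E F : List (Fin n) → Prop) :
    offerProb t (fun l => E l ∨ F l) ≤ offerProb t E + offerProb t F := by
  unfold offerProb
  rw [← offerMean_add]
  refine offerMean_mono fun l _ => ?_
  by_cases hE : E l <;> by_cases hF : F l <;> simp [hE, hF]

theorem offerMean_eq_sum_div (t : ℕ) (Q : List (Fin n) → ℝ) :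
    offerMean t Q = (∑ ω : Fin t → Fin n, Q (List.ofFn ω)) / (n : ℝ) ^ t := by
  induction t generalizing Q with
  | zero => simp [offerMean]
  | succ t ih =>
    have h : ∑ ω : Fin (t + 1) → Fin n, Q (List.ofFn ω) =
        ∑ u, ∑ ω : Fin t → Fin n, Q (u :: List.ofFn ω) := by
      rw [← (Fin.consEquiv fun _ : Fin (t + 1) => Fin n).sum_comp, Fintype.sum_prod_type]
      simp [Fin.consEquiv, List.ofFn_succ]
    simp only [offerMean, ih, h, ← Finset.sum_div, pow_succ, div_div]

theorem starProb_eq_offerProb (t : ℕ) (σ : StarStrategy n) (H : SimpleGraph (Fin n)) :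
    starProb n t σ H = offerProb t (fun l => ContainsCopy (starBuild σ l) H) := by
  classical
  rw [offerProb, offerMean_eq_sum_div, starProb, Finset.sum_boole, Nat.card_eq_fintype_card,
    Fintype.card_subtype]

theorem offerProb_le_one (hn : 0 < n) (t : ℕ) (E : List (Fin n) → Prop) :
    offerProb t E ≤ 1 := by
  rw [← offerMean_const hn t 1]
  exact offerMean_mono fun l _ => by split_ifs <;> norm_num

end Mean

section Strategies

variable {n : ℕ}

theorem starBuildAux_append (σ : StarStrategy n) (h l l' : List (Fin n)) :
    starBuildAux σ h (l ++ l') = starBuildAux σ h l ⊔ starBuildAux σ (h ++ l) l' := by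
  induction l generalizing h with
  | nil => simp [starBuildAux]
  | cons u l ih => simp [starBuildAux, ih, sup_assoc]

theorem starBuildAux_congr {σ τ : StarStrategy n} {h k : List (Fin n)} (l : List (Fin n))
    (hστ : ∀ l' u, l'.length < l.length → σ (h ++ l') u = τ (k ++ l') u) :
    starBuildAux σ h l = starBuildAux τ k l := by
  induction l generalizing h k with
  | nil => rfl
  | cons u l ih =>
    simp only [starBuildAux]
    congr 1
    · have := hστ [] u (by simp)
      simp only [List.append_nil] at this
      simp [starStep, this]
    · refine ih fun l' v hl' => ?_
      simpa using hστ (u :: l') v (by simpa using hl')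

/-- Playing for `t` further rounds from the graph `G`, Builder can obtain a copy of `H` with
probability at least `q`. -/
def Wins (H : SimpleGraph (Fin n)) (t : ℕ) (q : ℝ) (G : SimpleGraph (Fin n)) : Prop :=
  ∃ σ : StarStrategy n, q ≤ offerProb t (fun l => ContainsCopy (G ⊔ starBuild σ l) H)

theorem ContainsCopy.mono {G G' H : SimpleGraph (Fin n)} (h : ContainsCopy G H) (hG : G ≤ G') :
    ContainsCopy G' H := by
  obtain ⟨φ, hφ, h⟩ := h
  exact ⟨φ, hφ, fun u v huv => hG (h u v huv)⟩

theorem ContainsCopy.trans {G K H : SimpleGraph (Fin n)} (h : ContainsCopy G K)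
    (h' : ContainsCopy K H) : ContainsCopy G H := by
  obtain ⟨φ, hφ, h⟩ := h
  obtain ⟨ψ, hψ, h'⟩ := h'
  exact ⟨φ ∘ ψ, hφ.comp hψ, fun u v huv => h _ _ (h' u v huv)⟩

/-- A target function listing the elements of `A`, and then `u` forever. -/
noncomputable def listTarget (A : Finset (Fin n)) (u : Fin n) (j : ℕ) : Fin n :=
  A.toList.getD j u

theorem exists_listTarget_eq {A : Finset (Fin n)} (u : Fin n) {a : Fin n} (ha : a ∈ A) :
    ∃ j < A.card, listTarget A u j = a := by
  obtain ⟨j, hj, h⟩ := List.getElem_of_mem (Finset.mem_toList.2 ha)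
  exact ⟨j, by simpa using hj, by rw [listTarget, List.getD_eq_getElem _ _ hj, h]⟩

/-- The strategy joining the `j`-th offer of `u` to the `j`-th element of `A u`. -/
noncomputable def targetStrategy (A : Fin n → Finset (Fin n)) : StarStrategy n :=
  fun h u => some (listTarget (A u) u (h.count u))

theorem starBuildAux_targetStrategy (A : Fin n → Finset (Fin n)) (h l : List (Fin n))
    {u : Fin n} {j : ℕ} (hj : h.count u ≤ j) (hj' : j < h.count u + l.count u)
    (hne : listTarget (A u) u j ≠ u) :
    (starBuildAux (targetStrategy A) h l).Adj u (listTarget (A u) u j) := by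
  induction l generalizing h with
  | nil => simp at hj'; omega
  | cons v l ih =>
    simp only [starBuildAux, SimpleGraph.sup_adj]
    by_cases hv : v = u
    · subst hv
      rcases hj.eq_or_lt with rfl | hlt
      · left
        simp [starStep, targetStrategy, hne.symm]
      · right
        refine ih _ ?_ ?_
        · simpa using hlt
        · simp at hj' ⊢; omega
    · right
      refine ih _ ?_ ?_
      · simpa [List.count_cons, hv] using hj
      · simpa [List.count_cons, hv] using hj'

/-- Builder plays `targetStrategy A` for `s` rounds, and then continues according to the outcome. -/
theorem Wins.of_targets (hn : 0 < n) {H G : SimpleGraph (Fin n)} {s t : ℕ} {p q : ℝ}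
    (A : Fin n → Finset (Fin n)) (E : List (Fin n) → Prop) (hE : offerProb s E ≤ p) (hq : q ≤ 1)
    (h : ∀ l : List (Fin n), l.length = s → ¬ E l → ∀ G' : SimpleGraph (Fin n), G ≤ G' →
      (∀ u, (A u).card ≤ l.count u → ∀ v ∈ A u, v ≠ u → G'.Adj u v) → Wins H t q G') :
    Wins H (s + t) (q - p) G := by
  classical
  set B : List (Fin n) → SimpleGraph (Fin n) := fun l => G ⊔ starBuild (targetStrategy A) l with hB
  have key : ∀ l : List (Fin n), ∃ σ : StarStrategy n, l.length = s → ¬ E l →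
      q ≤ offerProb t (fun l' => ContainsCopy (B l ⊔ starBuild σ l') H) := by
    intro l
    by_cases hl : l.length = s ∧ ¬ E l
    · obtain ⟨σ, hσ⟩ := h l hl.1 hl.2 (B l) le_sup_left (by
        intro u hu v hv hvu
        obtain ⟨j, hj, rfl⟩ := exists_listTarget_eq u hv
        refine SimpleGraph.sup_adj _ _ _ _ |>.2 (Or.inr ?_)
        exact starBuildAux_targetStrategy A [] l (by simp) (by simp; omega) hvu)
      exact ⟨σ, fun _ _ => hσ⟩
    · exact ⟨fun _ _ => none, fun h1 h2 => absurd ⟨h1, h2⟩ hl⟩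
  choose σ hσ using key
  let τ : StarStrategy n := fun h u =>
    if h.length < s then targetStrategy A h u else σ (h.take s) (h.drop s) u
  have hτ : ∀ l l' : List (Fin n), l.length = s →
      starBuild τ (l ++ l') = starBuild (targetStrategy A) l ⊔ starBuild (σ l) l' := by
    intro l l' hl
    unfold starBuild
    rw [starBuildAux_append]
    congr 1
    · refine starBuildAux_congr l fun m u hm => ?_
      simp [τ, hl ▸ hm]
    · refine starBuildAux_congr l' fun m u hm => ?_
      simp [τ, hl]
  refine ⟨τ, ?_⟩
  rw [offerProb, offerMean_append]
  have : q - offerProb s E ≤ offerMean s (fun l => offerMean t (fun l' =>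
      if ContainsCopy (G ⊔ starBuild τ (l ++ l')) H then (1 : ℝ) else 0)) := by
    have h1 : q - offerProb s E = offerMean s (fun l => q + (-1) * if E l then (1 : ℝ) else 0) := by
      rw [offerMean_add, offerMean_const_mul, offerMean_const hn, offerProb]; ring
    rw [h1]
    refine offerMean_mono fun l hl => ?_
    have h0 : 0 ≤ offerMean t (fun l' =>
        if ContainsCopy (G ⊔ starBuild τ (l ++ l')) H then (1 : ℝ) else 0) :=
      offerMean_nonneg fun l => by split_ifs <;> norm_num
    by_cases hEl : E l
    · simp only [hEl, if_true]; linarith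
    · simp only [hEl, if_false]
      have := hσ l hl hEl
      simp only [offerProb, hB] at this
      simp only [hτ l _ hl, ← sup_assoc]
      linarith
  linarith

theorem Wins.mono_rounds (hn : 0 < n) {H G : SimpleGraph (Fin n)} {t t' : ℕ} {q : ℝ} (hq : q ≤ 1)
    (ht : t ≤ t') (h : ∀ G', G ≤ G' → Wins H t q G') : Wins H t' q G := by
  have := Wins.of_targets hn (H := H) (G := G) (s := t' - t) (t := t) (p := 0) (q := q)
    (fun _ => ∅) (fun _ => False) (by simp [offerProb, offerMean_zero]) hq
    (fun l _ _ G' hG' _ => h G' hG')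
  simpa [Nat.sub_add_cancel ht] using this

theorem Wins.of_containsCopy (hn : 0 < n) {H G : SimpleGraph (Fin n)} (h : ContainsCopy G H)
    (t : ℕ) : Wins H t 1 G := by
  refine ⟨fun _ _ => none, ?_⟩
  rw [← offerMean_const hn t 1]
  exact offerMean_mono fun l _ => by simp [h.mono le_sup_left]

theorem Wins.mono_prob {H G : SimpleGraph (Fin n)} {t : ℕ} {q q' : ℝ} (h : Wins H t q G)
    (hq : q' ≤ q) : Wins H t q' G := by
  obtain ⟨σ, hσ⟩ := h
  exact ⟨σ, hq.trans hσ⟩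

end Strategies

section Concentration

variable {n : ℕ}

theorem offerMean_pow_countP (hn : 0 < n) (U : Finset (Fin n)) (x : ℝ) (t : ℕ) :
    offerMean t (fun l => x ^ l.countP (· ∈ U)) = (1 - (1 - x) * U.card / n) ^ t := by
  induction t with
  | zero => simp [offerMean]
  | succ t ih =>
    have h : ∀ u : Fin n, offerMean t (fun l => x ^ (u :: l).countP (· ∈ U)) =
        (1 - (1 - x) * U.card / n) ^ t * (1 + if u ∈ U then x - 1 else 0) := by
      intro u
      rw [← ih, mul_comm, ← offerMean_const_mul]
      congr 1
      funext l
      by_cases hu : u ∈ U <;> simp [hu, pow_succ, mul_comm]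
    simp only [offerMean, h, ← Finset.mul_sum, Finset.sum_add_distrib]
    rw [pow_succ, mul_div_assoc]
    congr 1
    have : (n : ℝ) ≠ 0 := by positivity
    simp
    field_simp
    ring

theorem List.countP_mem_finset_eq_sum {α : Type*} [DecidableEq α] (U : Finset α) (l : List α) :
    l.countP (· ∈ U) = ∑ u ∈ U, l.count u := by
  induction l with
  | nil => simp
  | cons a l ih =>
    simp [List.countP_cons, List.count_cons, ih, Finset.sum_add_distrib]

/-- In `t` rounds, all vertices of a set `U` are offered less than `m` times with probability at
most `q ^ #U`. -/
def LowBound (n t m : ℕ) (q : ℝ) : Prop :=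
  ∀ U : Finset (Fin n), offerProb t (fun l => ∀ u ∈ U, l.count u < m) ≤ q ^ U.card

theorem lowBound_of_exp_le (hn : 0 < n) {t m : ℕ} {x q : ℝ} (hx0 : 0 ≤ x) (hx1 : x ≤ 1)
    (hxm : 0 < x ^ m) (hq : Real.exp (-((1 - x) * (t / n))) ≤ q * x ^ m) :
    LowBound n t (m + 1) q := by
  intro U
  have hn' : (0 : ℝ) < n := by positivity
  have h1 : offerProb t (fun l : List (Fin n) => ∀ u ∈ U, l.count u < m + 1) ≤
      (x ^ (m * U.card))⁻¹ * offerMean t (fun l : List (Fin n) => x ^ l.countP (· ∈ U)) := by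
    rw [← offerMean_const_mul]
    refine offerMean_mono fun l _ => ?_
    have hpos : 0 < x ^ (m * U.card) := by rw [pow_mul]; positivity
    split_ifs with h
    · have hc : l.countP (· ∈ U) ≤ m * U.card := by
        rw [List.countP_mem_finset_eq_sum, mul_comm]
        exact Finset.sum_le_card_nsmul _ _ _ fun u hu => Nat.lt_succ_iff.1 (h u hu)
      rw [← div_eq_inv_mul, le_div_iff₀ hpos, one_mul]
      exact pow_le_pow_of_le_one hx0 hx1 hc
    · positivity
  refine h1.trans ?_
  rw [offerMean_pow_countP hn, pow_mul, ← inv_pow]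
  have hU : (U.card : ℝ) ≤ n := by
    exact_mod_cast (Finset.card_le_univ U).trans_eq (Fintype.card_fin n)
  have h2 : (1 - (1 - x) * U.card / n : ℝ) ^ t ≤ (q * x ^ m) ^ U.card := by
    calc (1 - (1 - x) * U.card / n : ℝ) ^ t ≤ (Real.exp (-((1 - x) * U.card / n))) ^ t := by
          gcongr
          · rw [sub_nonneg, div_le_one hn']
            nlinarith [Nat.cast_nonneg (α := ℝ) U.card]
          · exact Real.one_sub_le_exp_neg _
      _ = (Real.exp (-((1 - x) * (t / n)))) ^ U.card := by
          rw [← Real.exp_nat_mul, ← Real.exp_nat_mul]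
          congr 1
          field_simp
      _ ≤ _ := by gcongr
  calc _ ≤ ((x ^ m)⁻¹) ^ U.card * (q * x ^ m) ^ U.card := by gcongr
    _ = q ^ U.card := by
      rw [← mul_pow]
      congr 1
      field_simp

theorem lowBound_one (hn : 0 < n) (t : ℕ) : LowBound n t 1 (Real.exp (-(t / n))) :=
  lowBound_of_exp_le hn (m := 0) le_rfl zero_le_one (by simp) (by simp)

theorem lowBound_of_eight_mul_le (hn : 0 < n) {μ m : ℕ} (hm : 8 * m ≤ μ) :
    LowBound n (μ * n) m (Real.exp (-(μ / 4))) := by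
  have hn' : (n : ℝ) ≠ 0 := by positivity
  have hm' : (8 * m : ℝ) ≤ μ := by exact_mod_cast hm
  have h : LowBound n (μ * n) (m + 1) (Real.exp (-(μ / 4))) := by
    refine lowBound_of_exp_le hn (x := 1 / 2) (by norm_num) (by norm_num) (by positivity) ?_
    have h2 : Real.exp (-m) ≤ (1 / 2 : ℝ) ^ m := by
      rw [← mul_neg_one, Real.exp_nat_mul]
      gcongr
      rw [Real.exp_neg, one_div]
      gcongr
      linarith [Real.add_one_le_exp (1 : ℝ)]
    calc _ ≤ Real.exp (-(μ / 4)) * Real.exp (-m) := by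
          rw [← Real.exp_add, Real.exp_le_exp]
          push_cast
          rw [mul_div_cancel_right₀ _ hn']
          linarith [Nat.cast_nonneg (α := ℝ) μ, Nat.cast_nonneg (α := ℝ) m]
      _ ≤ _ := by gcongr
  intro U
  exact (offerProb_mono fun l _ hl u hu => (hl u hu).trans (Nat.lt_succ_self m)).trans (h U)

/-- Offering a vertex `(1 + 2 / L) m` times on average, where `m` is `L ^ 10 / 2`. -/
theorem lowBound_of_excess (hn : 0 < n) {m L : ℕ} (hL : 2 ≤ L) (hm : 2 * m = L ^ 10) :
    LowBound n ((m + L ^ 9) * n) m (Real.exp (-(L ^ 8 / 2))) := by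
  have hn' : (n : ℝ) ≠ 0 := by positivity
  have hL' : (2 : ℝ) ≤ L := by exact_mod_cast hL
  have hL0 : (0 : ℝ) < L := by linarith
  have hm' : (m : ℝ) = L ^ 10 / 2 := by
    have : (2 * m : ℝ) = L ^ 10 := by exact_mod_cast hm
    linarith
  have hinv : (1 / L : ℝ) ≤ 1 / 2 := by gcongr
  have h : LowBound n ((m + L ^ 9) * n) (m + 1) (Real.exp (-(L ^ 8 / 2))) := by
    have hx : (0 : ℝ) < 1 - 1 / L := by linarith
    refine lowBound_of_exp_le hn (x := 1 - 1 / L) hx.le (by simp) (by positivity) ?_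
    have h2 : Real.exp (-(m * (1 / L + (1 / L) ^ 2))) ≤ (1 - 1 / L : ℝ) ^ m := by
      rw [← mul_neg, Real.exp_nat_mul]
      gcongr
      set s : ℝ := 1 / L with hs
      have hs0 : 0 < s := by positivity
      rw [Real.exp_neg, inv_le_iff_one_le_mul₀ (Real.exp_pos _)]
      have h5 : s ≤ (1 - s) * (1 + s) ^ 2 / 2 := by nlinarith
      calc (1 : ℝ) ≤ (1 - s) * (1 + (s + s ^ 2) + (s + s ^ 2) ^ 2 / 2) := by
            nlinarith [mul_le_mul_of_nonneg_left h5 (sq_nonneg s)]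
        _ ≤ (1 - s) * Real.exp (s + s ^ 2) := by
            gcongr
            exact Real.quadratic_le_exp_of_nonneg (by positivity)
    calc _ ≤ Real.exp (-(L ^ 8 / 2)) * Real.exp (-(m * (1 / L + (1 / L) ^ 2))) := by
          rw [← Real.exp_add, Real.exp_le_exp]
          push_cast
          rw [mul_div_cancel_right₀ _ hn', hm']
          apply le_of_eq
          field_simp
          ring
      _ ≤ _ := by gcongr
  intro U
  exact (offerProb_mono fun l _ hl u hu => (hl u hu).trans (Nat.lt_succ_self m)).trans (h U)

theorem Finset.exists_pairwise_disjoint_subset {α β : Type*} [DecidableEq α] [DecidableEq β]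
    (F : Finset α) (W : α → Finset β) (hne : ∀ i ∈ F, (W i).Nonempty) {d : ℕ}
    (hd : ∀ i ∈ F, (F.filter fun j => ¬ Disjoint (W i) (W j)).card ≤ d) :
    ∃ J ⊆ F, (J : Set α).PairwiseDisjoint W ∧ F.card ≤ d * J.card := by
  induction F using Finset.strongInduction with
  | H F ih =>
    rcases F.eq_empty_or_nonempty with rfl | ⟨a, ha⟩
    · exact ⟨∅, by simp⟩
    set F' := F.filter fun j => Disjoint (W a) (W j) with hF'
    have hsub : F' ⊆ F := Finset.filter_subset _ _
    have haF' : a ∉ F' := by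
      simpa [hF', ha] using (hne a ha).ne_empty
    obtain ⟨J, hJ, hdis, hcard⟩ := ih F' (Finset.ssubset_iff_subset_ne.2
      ⟨hsub, fun h => haF' (h ▸ ha)⟩) (fun i hi => hne i (hsub hi)) (fun i hi =>
        (Finset.card_le_card (Finset.filter_subset_filter _ hsub)).trans (hd i (hsub hi)))
    have haJ : a ∉ J := fun h => haF' (hJ h)
    refine ⟨insert a J, Finset.insert_subset ha (hJ.trans hsub), ?_, ?_⟩
    · rw [Finset.coe_insert, Set.pairwiseDisjoint_insert]
      exact ⟨hdis, fun j hj _ => (Finset.mem_filter.1 (hJ hj)).2⟩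
    · rw [Finset.card_insert_of_notMem haJ, mul_add, mul_one,
        ← Finset.card_filter_add_card_filter_not (s := F) fun j => Disjoint (W a) (W j)]
      exact add_le_add hcard (hd a ha)

theorem offerProb_forall_le_pow {t m ℓ w : ℕ} {q : ℝ} (hq0 : 0 ≤ q) (hq : LowBound n t m q)
    (J : Finset (Fin n)) (W : Fin n → Finset (Fin n)) (hW : ∀ i ∈ J, (W i).card ≤ w)
    (hJ : (J : Set (Fin n)).PairwiseDisjoint W) :
    offerProb t (fun l => ∀ i ∈ J, ℓ ≤ ((W i).filter fun u => l.count u < m).card) ≤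
      (w.choose ℓ * q ^ ℓ) ^ J.card := by
  classical
  have h1 : offerProb t (fun l : List (Fin n) =>
      ∀ i ∈ J, ℓ ≤ ((W i).filter fun u => l.count u < m).card) ≤
      offerProb t (fun l => ∃ U ∈ J.pi fun i => (W i).powersetCard ℓ,
        ∀ u ∈ J.attach.biUnion fun i => U i.1 i.2, l.count u < m) := by
    refine offerProb_mono fun l _ hl => ?_
    have : ∀ i, ∀ hi : i ∈ J, ∃ A ∈ (W i).powersetCard ℓ, ∀ u ∈ A, l.count u < m := by
      intro i hi
      obtain ⟨A, hA, hc⟩ := Finset.exists_subset_card_eq (hl i hi)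
      refine ⟨A, Finset.mem_powersetCard.2 ⟨hA.trans (Finset.filter_subset _ _), hc⟩,
        fun u hu => ?_⟩
      exact (Finset.mem_filter.1 (hA hu)).2
    choose A hA hA' using this
    refine ⟨A, Finset.mem_pi.2 hA, fun u hu => ?_⟩
    obtain ⟨i, _, hi⟩ := Finset.mem_biUnion.1 hu
    exact hA' i.1 i.2 u hi
  refine h1.trans ((offerProb_exists_le _ _ _).trans ?_)
  have h2 : ∀ U ∈ J.pi fun i => (W i).powersetCard ℓ,
      offerProb t (fun l => ∀ u ∈ J.attach.biUnion fun i => U i.1 i.2, l.count u < m) ≤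
        (q ^ ℓ) ^ J.card := by
    intro U hU
    refine (hq _).trans_eq ?_
    have hU' := fun i hi => Finset.mem_powersetCard.1 (Finset.mem_pi.1 hU i hi)
    rw [Finset.card_biUnion, Finset.sum_congr rfl fun i _ => (hU' i.1 i.2).2]
    · simp [← pow_mul, mul_comm]
    · intro i _ j _ hij
      exact (hJ i.2 j.2 fun h => hij (Subtype.ext h)).mono (hU' i.1 i.2).1 (hU' j.1 j.2).1
  refine (Finset.sum_le_card_nsmul _ _ _ h2).trans ?_
  rw [Finset.card_pi, nsmul_eq_mul, mul_pow]
  push_cast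
  gcongr
  rw [← Finset.prod_const]
  refine Finset.prod_le_prod (fun _ _ => by positivity) fun i hi => ?_
  rw [Finset.card_powersetCard]
  exact_mod_cast Nat.choose_le_choose _ (hW i hi)

theorem choose_mul_sq_pow_le (hn : 0 < n) {r : ℝ} (hr : 0 ≤ r) (hr6 : r ≤ 1 / 6) :
    (n.choose (⌊r * n⌋₊ + 1) : ℝ) * (r ^ 2) ^ (⌊r * n⌋₊ + 1) ≤ 3 / √n := by
  set b := ⌊r * n⌋₊ + 1 with hb
  have hrn : r * n ≤ b := by
    rw [hb]; push_cast; exact (Nat.lt_floor_add_one _).le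
  have h1 : (n.choose b : ℝ) * (r ^ 2) ^ b ≤ (Real.exp 1 * r) ^ b := by
    calc (n.choose b : ℝ) * (r ^ 2) ^ b ≤ (n : ℝ) ^ b / b.factorial * (r ^ 2) ^ b := by
          gcongr; exact Nat.choose_le_pow_div b n
      _ = (r * n) ^ b / b.factorial * r ^ b := by rw [mul_pow, ← pow_mul, mul_comm 2, pow_mul]; ring
      _ ≤ (b : ℝ) ^ b / b.factorial * r ^ b := by gcongr
      _ ≤ Real.exp b * r ^ b := by
          gcongr; exact Real.pow_div_factorial_le_exp _ (by positivity) _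
      _ = (Real.exp 1 * r) ^ b := by rw [mul_pow, ← Real.exp_nat_mul, mul_one]
  refine h1.trans ?_
  have he : Real.exp 1 ≤ 3 := Real.exp_one_lt_three.le
  have hs : 0 < √(n : ℝ) := Real.sqrt_pos.2 (by positivity)
  have hss : √(n : ℝ) * √n = n := Real.mul_self_sqrt (by positivity)
  have h3 : Real.exp 1 * r ≤ 1 / 2 := by nlinarith
  rcases le_total (r * √n) 1 with h | h
  · calc (Real.exp 1 * r) ^ b ≤ (Real.exp 1 * r) ^ 1 :=
          pow_le_pow_of_le_one (by positivity) (by linarith) (by omega)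
      _ ≤ 3 * r := by rw [pow_one]; gcongr
      _ ≤ 3 / √n := by rw [le_div_iff₀ hs]; linarith
  · have hb' : √(n : ℝ) ≤ b := by nlinarith
    calc (Real.exp 1 * r) ^ b ≤ (1 / 2) ^ b := by gcongr
      _ ≤ 1 / b := by
          rw [one_div_pow]
          gcongr
          exact_mod_cast Nat.lt_two_pow_self.le
      _ ≤ 3 / √n := by gcongr; norm_num

theorem offerProb_card_low_le (hn : 0 < n) {t m ℓ w d : ℕ} {q r : ℝ} (hq0 : 0 ≤ q)
    (hq : LowBound n t m q) (hℓ : 0 < ℓ) (hr : 0 ≤ r) (hr6 : r ≤ 1 / 6)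
    (hqr : w.choose ℓ * q ^ ℓ ≤ r ^ 2) (I : Finset (Fin n)) (W : Fin n → Finset (Fin n))
    (hW : ∀ i ∈ I, (W i).card ≤ w)
    (hd : ∀ i ∈ I, (I.filter fun j => ¬ Disjoint (W i) (W j)).card ≤ d) :
    offerProb t (fun l => d * (r * n) <
      (I.filter fun i => ℓ ≤ ((W i).filter fun u => l.count u < m).card).card) ≤ 3 / √n := by
  classical
  set b := ⌊r * n⌋₊ + 1 with hb
  set P := (I.powersetCard b).filter fun J : Finset (Fin n) =>
    (J : Set (Fin n)).PairwiseDisjoint W with hP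
  have h1 : offerProb t (fun l : List (Fin n) => d * (r * n) <
      (I.filter fun i => ℓ ≤ ((W i).filter fun u => l.count u < m).card).card) ≤
      offerProb t (fun l => ∃ J ∈ P, ∀ i ∈ J, ℓ ≤ ((W i).filter fun u => l.count u < m).card) := by
    refine offerProb_mono fun l _ hl => ?_
    set F := I.filter fun i => ℓ ≤ ((W i).filter fun u => l.count u < m).card with hF
    have hFI : F ⊆ I := Finset.filter_subset _ _
    obtain ⟨J, hJF, hJ, hc⟩ := F.exists_pairwise_disjoint_subset W (d := d)
      (fun i hi => by
        have := hℓ.trans_le (Finset.mem_filter.1 hi).2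
        exact (Finset.card_pos.1 this).mono (Finset.filter_subset _ _))
      (fun i hi => (Finset.card_le_card (Finset.filter_subset_filter _ hFI)).trans (hd i (hFI hi)))
    have hbJ : b ≤ J.card := by
      rw [hb, Nat.add_one_le_iff, Nat.floor_lt (by positivity)]
      have hc' : (F.card : ℝ) ≤ d * J.card := by exact_mod_cast hc
      have := hl.trans_le hc'
      exact lt_of_mul_lt_mul_left this (by positivity)
    obtain ⟨J', hJ', hcard⟩ := Finset.exists_subset_card_eq hbJ
    refine ⟨J', ?_, fun i hi => (Finset.mem_filter.1 (hJF (hJ' hi))).2⟩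
    rw [hP, Finset.mem_filter, Finset.mem_powersetCard]
    exact ⟨⟨(hJ'.trans hJF).trans hFI, hcard⟩, hJ.subset (by exact_mod_cast hJ')⟩
  refine h1.trans ((offerProb_exists_le _ _ _).trans ?_)
  have h2 : ∀ J ∈ P, offerProb t (fun l : List (Fin n) =>
      ∀ i ∈ J, ℓ ≤ ((W i).filter fun u => l.count u < m).card) ≤ (r ^ 2) ^ b := by
    intro J hJ
    rw [hP, Finset.mem_filter, Finset.mem_powersetCard] at hJ
    refine (offerProb_forall_le_pow hq0 hq J W (fun i hi => hW i (hJ.1.1 hi)) hJ.2).trans ?_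
    rw [hJ.1.2]
    gcongr
  refine (Finset.sum_le_card_nsmul _ _ _ h2).trans ?_
  refine le_trans ?_ (choose_mul_sq_pow_le hn hr hr6)
  rw [nsmul_eq_mul]
  gcongr
  refine (Finset.card_filter_le _ _).trans ?_
  rw [Finset.card_powersetCard]
  exact Nat.choose_le_choose _ ((Finset.card_le_univ I).trans_eq (Fintype.card_fin n))

end Concentration

section Swaps

variable {n : ℕ}

open Classical in
/-- The neighbours of `u` in `K`. -/
noncomputable def nbrs (K : SimpleGraph (Fin n)) (u : Fin n) : Finset (Fin n) :=
  Finset.univ.filter (K.Adj u)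

@[simp]
theorem mem_nbrs {K : SimpleGraph (Fin n)} {u v : Fin n} : v ∈ nbrs K u ↔ K.Adj u v := by
  simp [nbrs]

/-- `G` contains all edges of `K` between vertices outside `S`. -/
def CoversOff (G K : SimpleGraph (Fin n)) (S : Finset (Fin n)) : Prop :=
  ∀ u v, K.Adj u v → u ∉ S → v ∉ S → G.Adj u v

theorem CoversOff.mono {G G' K : SimpleGraph (Fin n)} {S : Finset (Fin n)}
    (h : CoversOff G K S) (hG : G ≤ G') : CoversOff G' K S :=
  fun u v huv hu hv => hG (h u v huv hu hv)

/-- `K` is a copy of `H`, embedded in `G` up to the edges meeting `S`. -/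
structure Embeds (H G K : SimpleGraph (Fin n)) (D : ℕ) (S : Finset (Fin n)) : Prop where
  copy : ContainsCopy K H
  degree : ∀ u, (nbrs K u).card ≤ D
  covers : CoversOff G K S

theorem Embeds.mono {H G G' K : SimpleGraph (Fin n)} {D : ℕ} {S : Finset (Fin n)}
    (h : Embeds H G K D S) (hG : G ≤ G') : Embeds H G' K D S :=
  ⟨h.copy, h.degree, h.covers.mono hG⟩

theorem Embeds.containsCopy {H G K : SimpleGraph (Fin n)} {D : ℕ}
    (h : Embeds H G K D ∅) : ContainsCopy G H :=
  h.copy.mono fun u v huv => h.covers u v huv (by simp) (by simp)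

/-- The involution exchanging `x` and `y x` for all `x ∈ X`. -/
theorem exists_involutive_swaps (X : Finset (Fin n)) (y : Fin n → Fin n)
    (hy : Set.InjOn y X) (hyX : ∀ x ∈ X, y x ∉ X) :
    ∃ π : Fin n → Fin n, Function.Involutive π ∧ (∀ x ∈ X, π x = y x) ∧
      (∀ x ∈ X, π (y x) = x) ∧ ∀ v, v ∉ X → (∀ x ∈ X, y x ≠ v) → π v = v := by
  classical
  let π : Fin n → Fin n := fun v =>
    if v ∈ X then y v else if h : ∃ x ∈ X, y x = v then h.choose else v
  have h1 : ∀ x ∈ X, π x = y x := fun x hx => by simp [π, hx]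
  have h2 : ∀ x ∈ X, π (y x) = x := by
    intro x hx
    have h : ∃ x' ∈ X, y x' = y x := ⟨x, hx, rfl⟩
    simp only [π, hyX x hx, if_false, dif_pos h]
    exact hy h.choose_spec.1 hx h.choose_spec.2
  have h3 : ∀ v, v ∉ X → (∀ x ∈ X, y x ≠ v) → π v = v := by
    intro v hv hv'
    have h : ¬ ∃ x ∈ X, y x = v := fun ⟨x, hx, h⟩ => hv' x hx h
    simp only [π, hv, if_false, dif_neg h]
  refine ⟨π, fun v => ?_, h1, h2, h3⟩
  by_cases hv : v ∈ X
  · rw [h1 v hv, h2 v hv]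
  · by_cases hv' : ∃ x ∈ X, y x = v
    · obtain ⟨x, hx, rfl⟩ := hv'
      rw [h2 x hx, h1 x hx]
    · push Not at hv'
      rw [h3 v hv hv', h3 v hv hv']

/-- Exchanging the roles of `x` and `y x` for all `x ∈ X` repairs the vertices of `X`. -/
theorem Embeds.swap {H G K : SimpleGraph (Fin n)} {D : ℕ} {S : Finset (Fin n)}
    (h : Embeds H G K D S) {X : Finset (Fin n)} (hX : X ⊆ S) (y : Fin n → Fin n)
    (hy : Set.InjOn y X) (hyS : ∀ x ∈ X, y x ∉ S)
    (hySadj : ∀ x ∈ X, ∀ s ∈ S, ¬ K.Adj (y x) s)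
    (hyy : ∀ x ∈ X, ∀ x' ∈ X, ¬ K.Adj (y x) (y x'))
    (hyz : ∀ x ∈ X, ∀ z, z ∉ S → K.Adj x z → G.Adj (y x) z)
    (hxx : ∀ x ∈ X, ∀ x' ∈ X, K.Adj x x' → G.Adj (y x) (y x'))
    (hxw : ∀ x ∈ X, ∀ w, K.Adj (y x) w → G.Adj x w) :
    ∃ K', Embeds H G K' D (S \ X) := by
  classical
  obtain ⟨π, hπ, hπx, hπy, hπo⟩ :=
    exists_involutive_swaps X y hy fun x hx hx' => hyS x hx (hX hx')
  refine ⟨K.comap π, ContainsCopy.trans ⟨π, hπ.injective, fun u v huv => ?_⟩ h.copy,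
    fun u => ?_, ?_⟩
  · simpa [hπ u, hπ v] using huv
  · refine le_trans (Finset.card_le_card_of_injOn π (fun v hv => ?_) hπ.injective.injOn)
      (h.degree (π u))
    simpa using hv
  · have key : ∀ u, u ∉ S \ X → (u ∈ X ∧ π u = y u) ∨ (∃ x ∈ X, y x = u ∧ π u = x) ∨
        (u ∉ S ∧ (∀ x ∈ X, y x ≠ u) ∧ π u = u) := by
      intro u hu
      by_cases huX : u ∈ X
      · exact Or.inl ⟨huX, hπx u huX⟩
      · have huS : u ∉ S := fun h => hu (Finset.mem_sdiff.2 ⟨h, huX⟩)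
        by_cases hu' : ∃ x ∈ X, y x = u
        · obtain ⟨x, hx, rfl⟩ := hu'
          exact Or.inr (Or.inl ⟨x, hx, rfl, hπy x hx⟩)
        · push Not at hu'
          exact Or.inr (Or.inr ⟨huS, hu', hπo u huX hu'⟩)
    intro u v huv hu hv
    rw [SimpleGraph.comap_adj] at huv
    rcases key u hu with ⟨huX, hu1⟩ | ⟨x, hx, rfl, hu1⟩ | ⟨huS, hu', hu1⟩ <;>
    rcases key v hv with ⟨hvX, hv1⟩ | ⟨x', hx', rfl, hv1⟩ | ⟨hvS, hv', hv1⟩ <;>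
    rw [hu1, hv1] at huv
    · exact absurd huv (hyy u huX v hvX)
    · exact absurd huv (hySadj u huX x' (hX hx'))
    · exact hxw u huX v huv
    · exact absurd huv.symm (hySadj v hvX x (hX hx))
    · exact hxx x hx x' hx' huv
    · exact hyz x hx v hvS huv
    · exact (hxw v hvX u huv.symm).symm
    · exact (hyz x' hx' u huS huv.symm).symm
    · exact h.covers u v huv huS hvS

/-- Distinct vertices without common neighbours, and not adjacent. -/
def Far (K : SimpleGraph (Fin n)) (u v : Fin n) : Prop :=
  u ≠ v ∧ ¬ K.Adj u v ∧ ∀ w, K.Adj u w → ¬ K.Adj v w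

theorem Far.symm {K : SimpleGraph (Fin n)} {u v : Fin n} (h : Far K u v) : Far K v u :=
  ⟨h.1.symm, fun h' => h.2.1 h'.symm, fun w hw hw' => h.2.2 w hw' hw⟩

theorem card_biUnion_nbrs_le {K : SimpleGraph (Fin n)} {D : ℕ} (hD : ∀ u, (nbrs K u).card ≤ D)
    (A : Finset (Fin n)) : (A.biUnion (nbrs K)).card ≤ A.card * D :=
  Finset.card_biUnion_le_card_mul _ _ _ fun u _ => hD u

open Classical in
theorem card_not_far_le {K : SimpleGraph (Fin n)} {D : ℕ} (hD : ∀ u, (nbrs K u).card ≤ D)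
    (u : Fin n) : (Finset.univ.filter fun v => ¬ Far K u v).card ≤ 1 + D + D * D := by
  have : (Finset.univ.filter fun v => ¬ Far K u v) ⊆
      {u} ∪ nbrs K u ∪ (nbrs K u).biUnion (nbrs K) := by
    intro v hv
    replace hv := (Finset.mem_filter.1 hv).2
    simp only [Finset.mem_union, Finset.mem_singleton, mem_nbrs, Finset.mem_biUnion]
    by_contra! hc
    exact hv ⟨fun h => hc.1.1 h.symm, hc.1.2, fun w hw hw' => hc.2 w hw hw'.symm⟩
  refine (Finset.card_le_card this).trans ((Finset.card_union_le _ _).trans ?_)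
  refine add_le_add ((Finset.card_union_le _ _).trans (add_le_add (by simp) (hD u))) ?_
  exact (card_biUnion_nbrs_le hD _).trans (Nat.mul_le_mul_right _ (hD u))

theorem exists_far_set {K : SimpleGraph (Fin n)} {D : ℕ} (hD : ∀ u, (nbrs K u).card ≤ D)
    (S : Finset (Fin n)) (k : ℕ) (hk : (S.card + k) * (1 + D + D * D) ≤ n) :
    ∃ Y : Finset (Fin n), Y.card = k ∧ (∀ u ∈ Y, ∀ s ∈ S, Far K s u) ∧
      ∀ u ∈ Y, ∀ v ∈ Y, u ≠ v → Far K u v := by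
  classical
  induction k with
  | zero => exact ⟨∅, by simp⟩
  | succ k ih =>
    obtain ⟨Y, hY, hYS, hYY⟩ := ih (le_trans (by gcongr; omega) hk)
    set B := (S ∪ Y).biUnion fun u => Finset.univ.filter fun v => ¬ Far K u v with hB
    have hBc : B.card < Fintype.card (Fin n) := by
      rw [Fintype.card_fin]
      refine (Finset.card_biUnion_le_card_mul _ _ _ fun u _ => card_not_far_le hD u).trans_lt ?_
      have h1 : (S ∪ Y).card ≤ S.card + k := hY ▸ Finset.card_union_le S Y
      nlinarith
    obtain ⟨v, hv⟩ := Finset.exists_mem_notMem_of_card_lt_card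
      (s := B) (t := Finset.univ) (by simpa using hBc)
    have hvB : ∀ u ∈ S ∪ Y, Far K u v := by
      intro u hu
      by_contra h
      exact hv.2 (Finset.mem_biUnion.2 ⟨u, hu, by simpa using h⟩)
    have hvY : v ∉ Y := fun h => (hvB v (Finset.mem_union_right _ h)).1 rfl
    refine ⟨insert v Y, by rw [Finset.card_insert_of_notMem hvY, hY], ?_, ?_⟩
    · intro u hu s hs
      rcases Finset.mem_insert.1 hu with rfl | h
      · exact hvB s (Finset.mem_union_left _ hs)
      · exact hYS u h s hs
    · intro u hu u' hu' hne
      rcases Finset.mem_insert.1 hu with rfl | h <;> rcases Finset.mem_insert.1 hu' with rfl | h'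
      · exact absurd rfl hne
      · exact (hvB u' (Finset.mem_union_right _ h')).symm
      · exact hvB u (Finset.mem_union_right _ h)
      · exact hYY u h u' h' hne

/-- Pools of `p` spare vertices `y x i`, one for every `x ∈ X`, pairwise far from each other and
from `S`. -/
structure IsPool (K : SimpleGraph (Fin n)) (S X : Finset (Fin n)) (p : ℕ)
    (y : Fin n → ℕ → Fin n) : Prop where
  far : ∀ x ∈ X, ∀ i < p, ∀ s ∈ S, Far K s (y x i)
  far' : ∀ x ∈ X, ∀ i < p, ∀ x' ∈ X, ∀ j < p, (x, i) ≠ (x', j) → Far K (y x i) (y x' j)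

theorem exists_isPool {K : SimpleGraph (Fin n)} {D : ℕ} (hD : ∀ u, (nbrs K u).card ≤ D)
    (S X : Finset (Fin n)) (hX : X ⊆ S) (p : ℕ)
    (hp : S.card * (p + 1) * (1 + D + D * D) ≤ n) : ∃ y, IsPool K S X p y := by
  classical
  obtain ⟨Y, hY, hYS, hYY⟩ := exists_far_set hD S (S.card * p)
    (by rwa [mul_add_one, add_comm] at hp)
  have hc : (X ×ˢ Finset.range p).card ≤ Y.card := by
    rw [Finset.card_product, Finset.card_range, hY]
    exact Nat.mul_le_mul_right _ (Finset.card_le_card hX)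
  rcases isEmpty_or_nonempty (Fin n) with hemp | hne
  · exact ⟨fun x _ => x, fun x => (hemp.false x).elim, fun x => (hemp.false x).elim⟩
  obtain ⟨f, hfY, hf⟩ := (Finset.finite_toSet (X ×ˢ Finset.range p)).exists_injOn_of_encard_le
    (t := (Y : Set (Fin n))) (by
      rw [Set.encard_coe_eq_coe_finsetCard, Set.encard_coe_eq_coe_finsetCard]
      exact_mod_cast hc)
  have hmem : ∀ x ∈ X, ∀ i < p, (x, i) ∈ X ×ˢ Finset.range p := fun x hx i hi => by simp [hx, hi]
  have hfm : ∀ x ∈ X, ∀ i < p, f (x, i) ∈ Y := fun x hx i hi => hfY (hmem x hx i hi)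
  refine ⟨fun x i => f (x, i), fun x hx i hi s hs => hYS _ (hfm x hx i hi) s hs,
    fun x hx i hi x' hx' j hj hne => hYY _ (hfm x hx i hi) _ (hfm x' hx' j hj) fun h => hne ?_⟩
  exact hf (hmem x hx i hi) (hmem x' hx' j hj) h

open Classical in
theorem exists_independent_subset {K : SimpleGraph (Fin n)} {D : ℕ}
    (hD : ∀ u, (nbrs K u).card ≤ D) (S : Finset (Fin n)) :
    ∃ X ⊆ S, (∀ x ∈ X, ∀ x' ∈ X, ¬ K.Adj x x') ∧ S.card ≤ (D + 1) * X.card := by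
  induction S using Finset.strongInduction with
  | H S ih =>
    rcases S.eq_empty_or_nonempty with rfl | ⟨a, ha⟩
    · exact ⟨∅, by simp⟩
    have hsub : S \ insert a (nbrs K a) ⊂ S :=
      Finset.ssubset_iff_subset_ne.2 ⟨Finset.sdiff_subset, fun h => by
        have := h ▸ ha; simp at this⟩
    obtain ⟨X, hX, hind, hc⟩ := ih _ hsub
    have haX : a ∉ X := fun h => by simpa using hX h
    have hXa : ∀ x ∈ X, ¬ K.Adj a x := fun x hx h => by
      have := hX hx
      simp [h] at this
    refine ⟨insert a X, Finset.insert_subset ha (hX.trans hsub.subset), ?_, ?_⟩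
    · intro x hx x' hx'
      rcases Finset.mem_insert.1 hx with rfl | h <;> rcases Finset.mem_insert.1 hx' with rfl | h'
      · exact K.irrefl
      · exact hXa x' h'
      · exact fun hadj => hXa x h hadj.symm
      · exact hind x h x' h'
    · have h1 : S.card ≤ (S \ insert a (nbrs K a)).card + (insert a (nbrs K a)).card := by
        have := Finset.le_card_sdiff (insert a (nbrs K a)) S
        omega
      have h2 : (insert a (nbrs K a)).card ≤ D + 1 :=
        (Finset.card_insert_le _ _).trans (by linarith [hD a])
      rw [Finset.card_insert_of_notMem haX]
      linarith

/-- A graph of maximum degree at most `2 m` has an orientation with out-degrees at most `m`. -/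
theorem exists_orientation {K : SimpleGraph (Fin n)} {m : ℕ}
    (hD : ∀ u, (nbrs K u).card ≤ 2 * m) :
    ∃ A : Fin n → Finset (Fin n), (∀ u, (A u).card ≤ m) ∧
      ∀ u v, K.Adj u v → v ∈ A u ∨ u ∈ A v := by
  classical
  let N : K.edgeSet → Finset (Fin n × Fin m) := fun e =>
    (Finset.univ.filter fun v => v ∈ e.1) ×ˢ Finset.univ
  have hall : ∀ s : Finset K.edgeSet, s.card ≤ (s.biUnion N).card := by
    intro s
    set Z : Finset (Fin n) := Finset.univ.filter fun v => ∃ e ∈ s, v ∈ e.1 with hZ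
    have h1 : s.biUnion N = Z ×ˢ Finset.univ := by
      ext ⟨v, j⟩
      simp [N, hZ]
    rw [h1, Finset.card_product, Finset.card_univ, Fintype.card_fin]
    have h2 : ∑ e ∈ s, (Z.filter fun v => v ∈ e.1).card = s.card * 2 := by
      rw [Finset.sum_const_nat]
      intro e he
      have h3 : (Z.filter fun v => v ∈ e.1) = e.1.toFinset := by
        ext v
        simp only [hZ, Finset.mem_filter, Finset.mem_univ, true_and, Sym2.mem_toFinset]
        exact ⟨fun h => h.2, fun h => ⟨⟨e, he, h⟩, h⟩⟩
      rw [h3, Sym2.card_toFinset_of_not_isDiag _ (K.not_isDiag_of_mem_edgeSet e.2)]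
    have h4 : ∑ v ∈ Z, (s.filter fun e => v ∈ e.1).card ≤ Z.card * (2 * m) := by
      refine Finset.sum_le_card_nsmul _ _ _ fun v _ => le_trans ?_ (hD v)
      refine Finset.card_le_card_of_injOn
        (fun e => if h : v ∈ e.1 then Sym2.Mem.other h else v) ?_ ?_
      · intro e he
        have hv : v ∈ e.1 := (Finset.mem_filter.1 he).2
        simp only [hv, dif_pos, Finset.mem_coe, mem_nbrs]
        rw [← SimpleGraph.mem_edgeSet, Sym2.other_spec hv]
        exact e.2
      · intro e he e' he' hee
        have hv : v ∈ e.1 := (Finset.mem_filter.1 he).2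
        have hv' : v ∈ e'.1 := (Finset.mem_filter.1 he').2
        simp only [hv, hv', dif_pos] at hee
        exact Subtype.ext (by rw [← Sym2.other_spec hv, ← Sym2.other_spec hv', hee])
    have h5 := Finset.sum_card_bipartiteAbove_eq_sum_card_bipartiteBelow (s := Z) (t := s)
      fun v e => v ∈ e.1
    simp only [Finset.bipartiteAbove, Finset.bipartiteBelow] at h5
    rw [h5, h2] at h4
    linarith
  obtain ⟨ι, hι, hιN⟩ := (Finset.all_card_le_biUnion_card_iff_exists_injective N).1 hall
  refine ⟨fun u => Finset.univ.filter fun v => ∃ h : K.Adj u v, (ι ⟨s(u, v), h⟩).1 = u,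
    fun u => ?_, fun u v huv => ?_⟩
  · refine (Finset.card_le_card_of_injOn (t := Finset.range m)
      (fun v => if h : K.Adj u v then ((ι ⟨s(u, v), h⟩).2 : ℕ) else 0) (fun v hv => ?_)
      ?_).trans_eq (Finset.card_range m)
    · obtain ⟨h, -⟩ := (Finset.mem_filter.1 hv).2
      simp [h]
    · intro v hv v' hv' hvv
      obtain ⟨h, h1⟩ := (Finset.mem_filter.1 hv).2
      obtain ⟨h', h1'⟩ := (Finset.mem_filter.1 hv').2
      simp only [h, h', dif_pos] at hvv
      have := hι (Prod.ext (h1.trans h1'.symm) (Fin.ext hvv))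
      exact Sym2.congr_right.1 (congrArg Subtype.val this)
  · have h := hιN ⟨s(u, v), huv⟩
    simp only [N, Finset.mem_product, Finset.mem_filter, Finset.mem_univ, true_and, and_true,
      Sym2.mem_iff] at h
    rcases h with h | h
    · left
      simpa using ⟨huv, h⟩
    · right
      have h' : (ι ⟨s(v, u), huv.symm⟩).1 = v := by
        have : (⟨s(v, u), huv.symm⟩ : K.edgeSet) = ⟨s(u, v), huv⟩ := Subtype.ext Sym2.eq_swap
        rw [this]
        exact h
      simpa using ⟨huv.symm, h'⟩

end Swaps

section Blocks

variable {n : ℕ}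

/-- One block of rounds: every item `(x, i)` wants the edge joining `u x i` to `τ x i`. -/
theorem Wins.block (hn : 0 < n) {H G : SimpleGraph (Fin n)} {T t s a : ℕ} {q r p : ℝ}
    (hq0 : 0 ≤ q) (hq : LowBound n T 1 q) (hr : 0 ≤ r) (hr6 : r ≤ 1 / 6) (has : a < s)
    (hqr : s.choose (s - a) * q ^ (s - a) ≤ r ^ 2) (X : Finset (Fin n)) (Q : Fin n → Finset ℕ)
    (hQ : ∀ x ∈ X, s ≤ (Q x).card) (u τ : Fin n → ℕ → Fin n)
    (hu : ∀ x ∈ X, ∀ i ∈ Q x, ∀ x' ∈ X, ∀ i' ∈ Q x', u x i = u x' i' → (x, i) = (x', i'))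
    (hp : p ≤ 1)
    (h : ∀ X' ⊆ X, ∀ Q' : Fin n → Finset ℕ, (∀ x ∈ X', Q' x ⊆ Q x) →
      (∀ x ∈ X', a ≤ (Q' x).card) → (X.card : ℝ) ≤ X'.card + r * n → ∀ G', G ≤ G' →
      (∀ x ∈ X', ∀ i ∈ Q' x, u x i ≠ τ x i → G'.Adj (u x i) (τ x i)) → Wins H t p G') :
    Wins H (T + t) (p - 3 / √n) G := by
  classical
  have hsub : ∀ x, ∃ P : Finset ℕ, x ∈ X → P ⊆ Q x ∧ P.card = s := fun x => by
    by_cases hx : x ∈ X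
    · obtain ⟨P, hP⟩ := Finset.exists_subset_card_eq (hQ x hx)
      exact ⟨P, fun _ => hP⟩
    · exact ⟨∅, fun h => absurd h hx⟩
  choose P hP using hsub
  have hinj : ∀ x ∈ X, Set.InjOn (u x) (P x) := fun x hx i hi i' hi' hii =>
    congrArg Prod.snd (hu x hx i ((hP x hx).1 hi) x hx i' ((hP x hx).1 hi') hii)
  let W : Fin n → Finset (Fin n) := fun x => (P x).image (u x)
  have hE := offerProb_card_low_le hn hq0 hq (ℓ := s - a) (w := s) (d := 1) (by omega) hr hr6 hqr
    X W (fun x hx => Finset.card_image_le.trans_eq (hP x hx).2) (fun x hx => by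
      refine Finset.card_le_one.2 ?_
      have key : ∀ x' ∈ X.filter fun j => ¬ Disjoint (W x) (W j), x = x' := by
        intro x' hx'
        obtain ⟨hx', hd⟩ := Finset.mem_filter.1 hx'
        obtain ⟨v, hv, hv'⟩ := Finset.not_disjoint_iff.1 hd
        obtain ⟨i, hi, rfl⟩ := Finset.mem_image.1 hv
        obtain ⟨i', hi', hii⟩ := Finset.mem_image.1 hv'
        exact congrArg Prod.fst (hu x hx i ((hP x hx).1 hi) x' hx' i' ((hP x' hx').1 hi') hii.symm)
      exact fun y hy z hz => (key y hy).symm.trans (key z hz))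
  refine Wins.of_targets hn
    (fun v => ((X.sigma fun x => P x).filter fun z => u z.1 z.2 = v).image fun z => τ z.1 z.2)
    _ hE hp fun l hl hEl G' hG' hadj => ?_
  rw [not_lt] at hEl
  set F := X.filter fun x => s - a ≤ ((W x).filter fun v => l.count v < 1).card with hF
  refine h (X \ F) Finset.sdiff_subset (fun x => (P x).filter fun i => 1 ≤ l.count (u x i))
    (fun x hx => (Finset.filter_subset _ _).trans (hP x (Finset.mem_sdiff.1 hx).1).1)
    (fun x hx => ?_) ?_ G' hG' fun x hx i hi hne => ?_
  · obtain ⟨hx, hxF⟩ := Finset.mem_sdiff.1 hx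
    have h1 : ((W x).filter fun v => l.count v < 1).card < s - a := by
      by_contra hc
      exact hxF (Finset.mem_filter.2 ⟨hx, not_lt.1 hc⟩)
    have h2 : ((P x).filter fun i => ¬ 1 ≤ l.count (u x i)).card =
        ((W x).filter fun v => l.count v < 1).card := by
      rw [Finset.filter_image, Finset.card_image_of_injOn]
      · simp only [not_le]
      · exact (hinj x hx).mono fun i hi => (Finset.mem_filter.1 hi).1
    have h3 := Finset.card_filter_add_card_filter_not (s := P x) fun i => 1 ≤ l.count (u x i)
    have h4 := (hP x hx).2
    omega
  · have h1 : X.card ≤ (X \ F).card + F.card := by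
      have := Finset.le_card_sdiff F X; omega
    have h2 : (X.card : ℝ) ≤ (X \ F).card + F.card := by exact_mod_cast h1
    simp only [Nat.cast_one, one_mul] at hEl
    linarith
  · obtain ⟨hx, -⟩ := Finset.mem_sdiff.1 hx
    obtain ⟨hi, hc⟩ := Finset.mem_filter.1 hi
    refine hadj (u x i) (le_trans ?_ hc) _ ?_ hne.symm
    · refine Finset.card_image_le.trans (Finset.card_le_one.2 ?_)
      have key : ∀ z ∈ (X.sigma fun x => P x).filter fun z => u z.1 z.2 = u x i, z = ⟨x, i⟩ := by
        rintro ⟨x', i'⟩ hz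
        obtain ⟨hz, hzu⟩ := Finset.mem_filter.1 hz
        obtain ⟨hx', hi'⟩ := Finset.mem_sigma.1 hz
        have := hu x' hx' i' ((hP x' hx').1 hi') x hx i ((hP x hx).1 hi) hzu
        simp only [Prod.mk.injEq] at this
        obtain ⟨rfl, rfl⟩ := this
        rfl
      exact fun y hy z hz => (key y hy).trans (key z hz).symm
    · exact Finset.mem_image.2 ⟨⟨x, i⟩, by simp [hx, hi], rfl⟩

theorem Wins.blocks (hn : 0 < n) {H : SimpleGraph (Fin n)} {T t : ℕ} {q r p : ℝ}
    (hq0 : 0 ≤ q) (hq : LowBound n T 1 q) (hr : 0 ≤ r) (hr6 : r ≤ 1 / 6) (hp : p ≤ 1) (J : ℕ) :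
    ∀ (s : ℕ → ℕ), (∀ j < J, s (j + 1) < s j) →
    (∀ j < J, (s j).choose (s j - s (j + 1)) * q ^ (s j - s (j + 1)) ≤ r ^ 2) →
    ∀ (u τ : ℕ → Fin n → ℕ → Fin n) (X : Finset (Fin n)) (Q : Fin n → Finset ℕ),
    (∀ x ∈ X, s 0 ≤ (Q x).card) →
    (∀ j < J, ∀ x ∈ X, ∀ i ∈ Q x, ∀ x' ∈ X, ∀ i' ∈ Q x', u j x i = u j x' i' →
      (x, i) = (x', i')) →
    ∀ G, (∀ X' ⊆ X, ∀ Q' : Fin n → Finset ℕ, (∀ x ∈ X', Q' x ⊆ Q x) →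
      (∀ x ∈ X', s J ≤ (Q' x).card) → (X.card : ℝ) ≤ X'.card + J * (r * n) → ∀ G', G ≤ G' →
      (∀ j < J, ∀ x ∈ X', ∀ i ∈ Q' x, u j x i ≠ τ j x i → G'.Adj (u j x i) (τ j x i)) →
      Wins H t p G') →
    Wins H (J * T + t) (p - J * (3 / √n)) G := by
  induction J with
  | zero =>
    intro s _ _ u τ X Q hQ _ G h
    simpa using h X subset_rfl Q (fun _ _ => subset_rfl) hQ (by simp) G le_rfl (by simp)
  | succ J ih =>
    intro s hs hsq u τ X Q hQ hu G h
    have h3 : 0 ≤ (J : ℝ) * (3 / √n) := by positivity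
    have := Wins.block hn (t := J * T + t) (p := p - J * (3 / √n)) hq0 hq hr hr6 (hs 0 (by omega))
      (hsq 0 (by omega)) X Q hQ (u 0) (τ 0) (hu 0 (by omega)) (H := H) (G := G) (by linarith) ?_
    · convert this using 1
      · ring
      · push_cast; ring
    · intro X' hX' Q' hQ' hQc hXc G' hG' hadj
      refine ih (fun j => s (j + 1)) (fun j hj => hs _ (by omega)) (fun j hj => hsq _ (by omega))
        (fun j => u (j + 1)) (fun j => τ (j + 1)) X' Q' hQc ?_ G' ?_
      · exact fun j hj x hx i hi x' hx' i' hi' => hu (j + 1) (by omega) x (hX' hx) i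
          (hQ' x hx hi) x' (hX' hx') i' (hQ' x' hx' hi')
      · intro X'' hX'' Q'' hQ'' hQc'' hXc'' G'' hG'' hadj''
        refine h X'' (hX''.trans hX') Q'' (fun x hx => (hQ'' x hx).trans (hQ' x (hX'' hx))) hQc''
          ?_ G'' (hG'.trans hG'') fun j hj x hx i hi hne => ?_
        · push_cast
          linarith
        · rcases j with _ | j
          · exact hG'' (hadj x (hX'' hx) i (hQ'' x hx hi) hne)
          · exact hadj'' j (by omega) x hx i hi hne

theorem listTarget_eq_or_mem (A : Finset (Fin n)) (u : Fin n) (j : ℕ) :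
    listTarget A u j = u ∨ listTarget A u j ∈ A := by
  rw [listTarget]
  rcases lt_or_ge j A.toList.length with hj | hj
  · rw [List.getD_eq_getElem _ _ hj]
    exact Or.inr (Finset.mem_toList.1 (List.getElem_mem hj))
  · exact Or.inl (List.getD_eq_default _ _ hj)

theorem Far.listTarget_ne {K : SimpleGraph (Fin n)} {u v : Fin n} (h : Far K u v) (j : ℕ) :
    listTarget (nbrs K u) u j ≠ listTarget (nbrs K v) v j := by
  intro he
  rcases listTarget_eq_or_mem (nbrs K u) u j with h1 | h1 <;>
  rcases listTarget_eq_or_mem (nbrs K v) v j with h2 | h2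
  · exact h.1 (h1.symm.trans (he.trans h2))
  · rw [← he, h1, mem_nbrs] at h2
    exact h.2.1 h2.symm
  · rw [he, h2, mem_nbrs] at h1
    exact h.2.1 h1
  · rw [← he] at h2
    exact h.2.2 _ (mem_nbrs.1 h1) (mem_nbrs.1 h2)

/-- Builder repairs most of an independent set `X₀` of unfinished vertices, using `2 * D` blocks of
`T` rounds. -/
theorem Wins.repair (hn : 0 < n) {H G K : SimpleGraph (Fin n)} {D T t : ℕ} {q r p : ℝ}
    {S X₀ : Finset (Fin n)} (hemb : Embeds H G K D S) (hX₀ : X₀ ⊆ S)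
    (hind : ∀ x ∈ X₀, ∀ x' ∈ X₀, ¬ K.Adj x x') {s : ℕ → ℕ} {y : Fin n → ℕ → Fin n}
    (hy : IsPool K S X₀ (s 0) y) (hq0 : 0 ≤ q) (hq : LowBound n T 1 q) (hr : 0 ≤ r)
    (hr6 : r ≤ 1 / 6) (hp : p ≤ 1) (hs : ∀ j < 2 * D, s (j + 1) < s j) (hsD : 0 < s (2 * D))
    (hsq : ∀ j < 2 * D, (s j).choose (s j - s (j + 1)) * q ^ (s j - s (j + 1)) ≤ r ^ 2)
    (h : ∀ X ⊆ X₀, (X₀.card : ℝ) ≤ X.card + 2 * D * (r * n) → ∀ G' K', Embeds H G' K' D (S \ X) →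
      Wins H t p G') :
    Wins H (2 * D * T + t) (p - 2 * D * (3 / √n)) G := by
  have hmain := Wins.blocks hn hq0 hq hr hr6 hp (2 * D) s hs hsq
    (fun j x i => if j < D then listTarget (nbrs K (y x i)) (y x i) j else y x i)
    (fun j x i => if j < D then x else listTarget (nbrs K x) x (j - D)) X₀
    (fun _ => Finset.range (s 0)) (fun x _ => by simp) ?_ G (H := H) (t := t) ?_
  · convert hmain using 2
    push_cast; ring
  · intro j hj x hx i hi x' hx' i' hi' he
    by_contra hne
    have hfar := hy.far' x hx i (Finset.mem_range.1 hi) x' hx' i' (Finset.mem_range.1 hi') hne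
    split_ifs at he
    · exact hfar.listTarget_ne j he
    · exact hfar.1 he
  · intro X hX Q hQ hQc hXc G' hG' hadj
    have hne : ∀ x, ∃ i, x ∈ X → i ∈ Q x := fun x => by
      by_cases hx : x ∈ X
      · obtain ⟨i, hi⟩ := Finset.card_pos.1 (hsD.trans_le (hQc x hx))
        exact ⟨i, fun _ => hi⟩
      · exact ⟨0, fun h => absurd h hx⟩
    choose ι hι using hne
    have hιp : ∀ x ∈ X, ι x < s 0 := fun x hx => Finset.mem_range.1 (hQ x hx (hι x hx))
    have hfar : ∀ x ∈ X, ∀ v ∈ S, Far K v (y x (ι x)) := fun x hx =>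
      hy.far x (hX hx) _ (hιp x hx)
    have hfar' : ∀ x ∈ X, ∀ x' ∈ X, x ≠ x' → Far K (y x (ι x)) (y x' (ι x')) :=
      fun x hx x' hx' hne => hy.far' x (hX hx) _ (hιp x hx) x' (hX hx') _ (hιp x' hx')
        fun he => hne (congrArg Prod.fst he)
    obtain ⟨K', hK'⟩ := (hemb.mono hG').swap (hX.trans hX₀) (fun x => y x (ι x))
      (fun x hx x' hx' he => by
        by_contra hne
        exact (hfar' x hx x' hx' hne).1 he)
      (fun x hx hxS => (hfar x hx _ hxS).1 rfl)
      (fun x hx v hv hadj => (hfar x hx v hv).2.1 hadj.symm)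
      (fun x hx x' hx' hadj => by
        rcases eq_or_ne x x' with rfl | hne
        · exact K.irrefl hadj
        · exact (hfar' x hx x' hx' hne).2.1 hadj)
      (fun x hx z hz hxz => by
        obtain ⟨j, hj, rfl⟩ := exists_listTarget_eq x (mem_nbrs.2 hxz)
        have hjD := hj.trans_le (hemb.degree x)
        have := hadj (D + j) (by omega) x hx (ι x) (hι x hx)
        simp only [add_lt_iff_neg_left, not_lt_zero, if_false, add_tsub_cancel_left] at this
        exact this fun he => (hfar x hx x (hX₀ (hX hx))).2.1 (he ▸ hxz))
      (fun x hx x' hx' hadj => absurd hadj (hind x (hX hx) x' (hX hx')))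
      (fun x hx w hw => by
        obtain ⟨j, hj, rfl⟩ := exists_listTarget_eq (y x (ι x)) (mem_nbrs.2 hw)
        have hjD := hj.trans_le (hemb.degree _)
        have := hadj j (by omega) x hx (ι x) (hι x hx)
        simp only [hjD, if_true] at this
        exact (this fun he => (hfar x hx x (hX₀ (hX hx))).2.1 (he ▸ hw).symm).symm)
    refine h X hX ?_ G' K' hK'
    push_cast at hXc
    linarith

end Blocks

section Finish

variable {n : ℕ}

theorem choose_mul_exp_pow_le {B D a s : ℕ} {q : ℝ} (hD : 1 ≤ D) (hB : 64 * (D + 1) ^ 2 ≤ B)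
    (ha : 1 ≤ a) (hs : s = a * B ^ 4) (hsB : s ≤ B ^ (8 * D)) (hq0 : 0 ≤ q)
    (hq : q ≤ Real.exp (-(1 / (B : ℝ) ^ 2))) :
    (s.choose (s - a) : ℝ) * q ^ (s - a) ≤ Real.exp (-((B : ℝ) ^ 2 / 4)) ^ 2 := by
  have hDB : 64 * D ≤ B := by nlinarith
  have hDB' : (64 * D : ℝ) ≤ B := by exact_mod_cast hDB
  have hB1 : (64 : ℝ) ≤ B := by exact_mod_cast (by omega : 64 ≤ B)
  have has : a ≤ s := hs ▸ Nat.le_mul_of_pos_right a (Nat.pow_pos (by omega))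
  have ha' : (1 : ℝ) ≤ a := by exact_mod_cast ha
  have h1 : (s.choose (s - a) : ℝ) ≤ Real.exp (a * (B ^ 2 / 8)) := by
    rw [Nat.choose_symm has]
    calc (s.choose a : ℝ) ≤ (s : ℝ) ^ a := by exact_mod_cast Nat.choose_le_pow s a
      _ ≤ ((B : ℝ) ^ (8 * D)) ^ a := by gcongr; exact_mod_cast hsB
      _ ≤ (Real.exp B ^ (8 * D)) ^ a := by
        gcongr
        linarith [Real.add_one_le_exp (B : ℝ)]
      _ = Real.exp (a * (8 * D * B)) := by
        rw [← Real.exp_nat_mul, ← Real.exp_nat_mul]; push_cast; ring_nf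
      _ ≤ _ := by gcongr; nlinarith
  have h2 : q ^ (s - a) ≤ Real.exp (-(a * (B ^ 2 - 1))) := by
    calc q ^ (s - a) ≤ Real.exp (-(1 / (B : ℝ) ^ 2)) ^ (s - a) := by gcongr
      _ = Real.exp (-(a * (B ^ 2 - 1 / (B : ℝ) ^ 2))) := by
        rw [← Real.exp_nat_mul, Nat.cast_sub has, hs]
        push_cast
        congr 1
        field_simp
      _ ≤ _ := by
        gcongr
        rw [div_le_one (by positivity)]
        nlinarith
  calc (s.choose (s - a) : ℝ) * q ^ (s - a)
      ≤ Real.exp (a * (B ^ 2 / 8)) * Real.exp (-(a * (B ^ 2 - 1))) := by gcongr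
    _ = Real.exp (-(a * (7 * B ^ 2 / 8 - 1))) := by rw [← Real.exp_add]; ring_nf
    _ ≤ Real.exp (-((B : ℝ) ^ 2 / 2)) := by
        gcongr
        have hB2 : (4096 : ℝ) ≤ B ^ 2 := by nlinarith
        nlinarith [mul_nonneg (sub_nonneg.2 ha') (by linarith : (0 : ℝ) ≤ 7 * B ^ 2 / 8 - 1)]
    _ = _ := by rw [← Real.exp_nat_mul]; push_cast; ring_nf

theorem shrink_bound {B D : ℕ} (hD : 1 ≤ D) (hB : 64 * (D + 1) ^ 2 ≤ B) {S X₀ S' : ℝ}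
    (hS0 : 0 ≤ S) (hS : S * B ^ (16 * D) ≤ n) (hX₀ : S ≤ (D + 1) * X₀)
    (hS' : S' ≤ S - X₀ + 2 * D * (Real.exp (-((B : ℝ) ^ 2 / 4)) * n)) :
    S' * (B + 1) ^ (16 * D) ≤ n := by
  have hDB : 128 * (D + 1) ≤ B := by nlinarith
  have hDB' : (128 * (D + 1) : ℝ) ≤ B := by exact_mod_cast hDB
  have hB' : (64 * (D + 1) ^ 2 : ℝ) ≤ B := by exact_mod_cast hB
  have hD' : (1 : ℝ) ≤ D := by exact_mod_cast hD
  have hB0 : (0 : ℝ) < B := by linarith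
  set ε : ℝ := 1 / (D + 1) with hε
  have hεD : ε * (D + 1) = 1 := by rw [hε]; field_simp
  have hε0 : 0 < ε := by positivity
  have hε1 : ε ≤ 1 / 2 := by rw [hε]; gcongr; linarith
  have h1 : ((B : ℝ) + 1) ^ (16 * D) ≤ B ^ (16 * D) * Real.exp (ε / 4) := by
    have : (B : ℝ) + 1 ≤ B * Real.exp (1 / B) := by
      have := Real.add_one_le_exp (1 / (B : ℝ))
      calc (B : ℝ) + 1 = B * (1 / B + 1) := by field_simp; ring
        _ ≤ _ := by gcongr
    calc ((B : ℝ) + 1) ^ (16 * D) ≤ (B * Real.exp (1 / B)) ^ (16 * D) := by gcongr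
      _ = B ^ (16 * D) * Real.exp (16 * D / B) := by
        rw [mul_pow, ← Real.exp_nat_mul]; push_cast; ring_nf
      _ ≤ _ := by
        refine mul_le_mul_of_nonneg_left (Real.exp_le_exp.2 ?_) (by positivity)
        rw [div_le_iff₀ hB0]
        have : 64 * (D + 1) ^ 2 * ε ≤ B * ε := by gcongr
        have h' : 64 * ((D : ℝ) + 1) ^ 2 * ε = 64 * (D + 1) * (ε * (D + 1)) := by ring
        rw [h', hεD] at this
        linarith
  have h2 : ((B : ℝ) + 1) ^ (16 * D) ≤ Real.exp (B ^ 2 / 8) := by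
    calc ((B : ℝ) + 1) ^ (16 * D) ≤ Real.exp B ^ (16 * D) := by
          gcongr; exact Real.add_one_le_exp _
      _ = Real.exp (16 * D * B) := by rw [← Real.exp_nat_mul]; push_cast; ring_nf
      _ ≤ _ := by gcongr; nlinarith
  have h3 : (1 - ε) * Real.exp (ε / 4) ≤ 1 - ε / 4 := by
    have ha : 1 - ε ≤ Real.exp (-ε) := by linarith [Real.add_one_le_exp (-ε)]
    have hb : Real.exp (-(3 * ε / 4)) * (1 + 3 * ε / 4) ≤ 1 := by
      rw [Real.exp_neg, inv_mul_le_iff₀ (Real.exp_pos _)]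
      linarith [Real.add_one_le_exp (3 * ε / 4)]
    have hc : (1 - ε) * Real.exp (ε / 4) ≤ Real.exp (-(3 * ε / 4)) := by
      calc _ ≤ Real.exp (-ε) * Real.exp (ε / 4) := by gcongr
        _ = _ := by rw [← Real.exp_add]; ring_nf
    have hd := Real.exp_pos (-(3 * ε / 4))
    refine hc.trans ?_
    nlinarith
  have h4 : 2 * D * Real.exp (-((B : ℝ) ^ 2 / 4)) * Real.exp (B ^ 2 / 8) ≤ ε / 4 := by
    rw [mul_assoc, ← Real.exp_add]
    have ha : -((B : ℝ) ^ 2 / 4) + B ^ 2 / 8 = -(B ^ 2 / 8) := by ring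
    rw [ha, Real.exp_neg, ← div_eq_mul_inv, div_le_iff₀ (Real.exp_pos _)]
    have hb := Real.add_one_le_exp ((B : ℝ) ^ 2 / 8)
    have hc : ε / 4 * (64 * (D + 1) ^ 2) ≤ ε / 4 * Real.exp (B ^ 2 / 8) := by
      gcongr
      nlinarith
    have h' : ε / 4 * (64 * ((D : ℝ) + 1) ^ 2) = 16 * (D + 1) * (ε * (D + 1)) := by ring
    rw [h', hεD] at hc
    linarith
  have h5 : S - X₀ ≤ S * (1 - ε) := by
    have : S * ε ≤ (D + 1) * X₀ * ε := by gcongr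
    nlinarith
  have hn0 : (0 : ℝ) ≤ n := by positivity
  have hP : 0 ≤ ((B : ℝ) + 1) ^ (16 * D) := by positivity
  calc S' * ((B : ℝ) + 1) ^ (16 * D)
      ≤ (S * (1 - ε) + 2 * D * (Real.exp (-((B : ℝ) ^ 2 / 4)) * n)) * (B + 1) ^ (16 * D) := by
        gcongr; linarith
    _ = S * (1 - ε) * (B + 1) ^ (16 * D) +
        n * (2 * D * Real.exp (-((B : ℝ) ^ 2 / 4)) * (B + 1) ^ (16 * D)) := by ring
    _ ≤ S * (1 - ε) * (B ^ (16 * D) * Real.exp (ε / 4)) +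
        n * (2 * D * Real.exp (-((B : ℝ) ^ 2 / 4)) * Real.exp (B ^ 2 / 8)) := by
        gcongr
        exact mul_nonneg hS0 (by linarith)
    _ = (S * B ^ (16 * D)) * ((1 - ε) * Real.exp (ε / 4)) +
        n * (2 * D * Real.exp (-((B : ℝ) ^ 2 / 4)) * Real.exp (B ^ 2 / 8)) := by ring
    _ ≤ n * (1 - ε / 4) + n * (ε / 4) := by
        refine add_le_add ?_ (by gcongr)
        exact mul_le_mul hS h3 (mul_nonneg (by linarith) (Real.exp_pos _).le) hn0
    _ = n := by ring

theorem Wins.repair_step (hn : 0 < n) {H G K : SimpleGraph (Fin n)} {B D t : ℕ} {p : ℝ}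
    (hD : 1 ≤ D) (hB : 64 * (D + 1) ^ 2 ≤ B) {S : Finset (Fin n)} (hemb : Embeds H G K D S)
    (hS : S.card * B ^ (16 * D) ≤ n) (hp : p ≤ 1)
    (h : ∀ S' G' K', Embeds H G' K' D S' → S'.card * (B + 1) ^ (16 * D) ≤ n → Wins H t p G') :
    Wins H (2 * D * (n / B ^ 2 + 1) + t) (p - 2 * D * (3 / √n)) G := by
  have hB1 : 2 ≤ B := by nlinarith
  have hDB : 1 + D + D * D ≤ B := by nlinarith
  obtain ⟨X₀, hX₀, hind, hcard⟩ := exists_independent_subset hemb.degree S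
  obtain ⟨y, hy⟩ := exists_isPool hemb.degree S X₀ hX₀ (B ^ (8 * D)) <| by
    refine le_trans ?_ hS
    rw [mul_assoc]
    gcongr
    calc (B ^ (8 * D) + 1) * (1 + D + D * D) ≤ (B ^ (8 * D) * B) * B := by
          gcongr
          have := Nat.one_le_pow (8 * D) B (by omega)
          nlinarith
      _ = B ^ (8 * D + 2) := by ring
      _ ≤ B ^ (16 * D) := by gcongr <;> omega
  have hn' : (0 : ℝ) < n := by positivity
  have hr6 : Real.exp (-((B : ℝ) ^ 2 / 4)) ≤ 1 / 6 := by
    have h64 : 64 ≤ B := by nlinarith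
    have : (64 : ℝ) ≤ B := by exact_mod_cast h64
    rw [Real.exp_neg, one_div]
    gcongr
    nlinarith [Real.add_one_le_exp ((B : ℝ) ^ 2 / 4)]
  have hT : 1 / (B : ℝ) ^ 2 ≤ ((n / B ^ 2 + 1 : ℕ) : ℝ) / n := by
    rw [div_le_div_iff₀ (by positivity) hn', one_mul]
    have := Nat.lt_div_mul_add (a := n) (b := B ^ 2) (by positivity)
    have h' : n ≤ (n / B ^ 2 + 1) * B ^ 2 := by linarith
    exact_mod_cast h'
  refine Wins.repair hn hemb hX₀ hind (s := fun j => B ^ (4 * (2 * D - j)))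
    (q := Real.exp (-(((n / B ^ 2 + 1 : ℕ) : ℝ) / n))) (r := Real.exp (-((B : ℝ) ^ 2 / 4)))
    (y := y) ?_ (Real.exp_pos _).le (lowBound_one hn _) (Real.exp_pos _).le hr6 hp ?_ ?_ ?_ ?_
  · convert hy using 2
    omega
  · exact fun j hj => Nat.pow_lt_pow_right (by omega) (by omega)
  · simp
  · intro j hj
    refine choose_mul_exp_pow_le hD hB (Nat.one_le_pow _ _ (by omega)) ?_ ?_ (Real.exp_pos _).le ?_
    · rw [← pow_add]; congr 1; omega
    · exact Nat.pow_le_pow_right (by omega) (by omega)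
    · gcongr
  · intro X hX hXc G' K' hemb'
    refine h _ _ _ hemb' ?_
    have hc : ((S \ X).card : ℝ) = S.card - X.card := by
      rw [Finset.card_sdiff_of_subset (hX.trans hX₀),
        Nat.cast_sub (Finset.card_le_card (hX.trans hX₀))]
    have := shrink_bound (n := n) hD hB (S := S.card) (X₀ := X₀.card) (S' := (S \ X).card)
      (by positivity) (by exact_mod_cast hS) (by exact_mod_cast hcard) (by linarith)
    exact_mod_cast this

theorem Wins.repair_chain (hn : 0 < n) {H : SimpleGraph (Fin n)} {D : ℕ} (hD : 1 ≤ D) (j : ℕ) :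
    ∀ B, 64 * (D + 1) ^ 2 ≤ B → n < (B + j) ^ (16 * D) → ∀ G K S, Embeds H G K D S →
      S.card * B ^ (16 * D) ≤ n →
      Wins H (∑ i ∈ Finset.range j, 2 * D * (n / (B + i) ^ 2 + 1))
        (1 - j * (2 * D * (3 / √n))) G := by
  induction j with
  | zero =>
    intro B _ hnB G K S hemb hS
    have : S = ∅ := by
      by_contra hne
      have := Finset.card_pos.2 (Finset.nonempty_iff_ne_empty.2 hne)
      simp only [add_zero] at hnB
      nlinarith
    subst this
    simpa using Wins.of_containsCopy hn hemb.containsCopy 0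
  | succ j ih =>
    intro B hB hnB G K S hemb hS
    have h0 : 0 ≤ (j : ℝ) * (2 * D * (3 / √n)) := by positivity
    have := Wins.repair_step hn hD hB hemb hS (p := 1 - j * (2 * D * (3 / √n)))
      (t := ∑ i ∈ Finset.range j, 2 * D * (n / (B + 1 + i) ^ 2 + 1)) (by linarith)
      fun S' G' K' hemb' hS' =>
        ih (B + 1) (by omega) (by convert hnB using 2; omega) G' K' S' hemb' hS'
    convert this using 1
    · rw [Finset.sum_range_succ', add_comm]
      simp only [add_zero, add_assoc, add_comm 1]
    · push_cast; ring

theorem sum_div_sq_le (B j : ℕ) (hB : 2 ≤ B) :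
    ((∑ i ∈ Finset.range j, n / (B + i) ^ 2 : ℕ) : ℝ) ≤ n * (1 / (B - 1) - 1 / (B + j - 1)) := by
  have hB' : (2 : ℝ) ≤ B := by exact_mod_cast hB
  induction j with
  | zero => simp
  | succ j ih =>
    rw [Finset.sum_range_succ]
    push_cast at ih ⊢
    have h1 : ((n / (B + j) ^ 2 : ℕ) : ℝ) ≤ n / ((B : ℝ) + j) ^ 2 := by
      exact_mod_cast Nat.cast_div_le (α := ℝ) (m := n) (n := (B + j) ^ 2)
    have hj : (0 : ℝ) ≤ j := by positivity
    have h2 : 1 / ((B : ℝ) + j) ^ 2 ≤ 1 / (B + j - 1) - 1 / (B + (j + 1) - 1) := by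
      have hc1 : (0 : ℝ) < B + j - 1 := by linarith
      have hc2 : (0 : ℝ) < B + j := by linarith
      have hc3 : (B : ℝ) + (j + 1) - 1 = B + j := by ring
      rw [hc3, div_sub_div _ _ hc1.ne' hc2.ne']
      rw [div_le_div_iff₀ (by positivity) (by positivity)]
      nlinarith
    have h3 : (n : ℝ) / ((B : ℝ) + j) ^ 2 ≤ n * (1 / (B + j - 1) - 1 / (B + (j + 1) - 1)) := by
      rw [div_eq_mul_one_div]; gcongr
    linarith

theorem sum_rounds_le {B D j k : ℕ} (hD : 1 ≤ D) (hDB : 256 * D ≤ B) (hDk : 2 * D ≤ k)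
    (hjk : j ≤ k) (hk : k ^ 16 ≤ n) :
    ∑ i ∈ Finset.range j, 2 * D * (n / (B + i) ^ 2 + 1) ≤ 2 * n := by
  have hD' : (1 : ℝ) ≤ D := by exact_mod_cast hD
  rw [← Finset.mul_sum, Finset.sum_add_distrib, Finset.sum_const, Finset.card_range,
    smul_eq_mul, mul_one, mul_add]
  have h1 := sum_div_sq_le (n := n) B j (by omega)
  have hB256 : (256 * D : ℝ) ≤ B := by exact_mod_cast hDB
  have hj0 : (0 : ℝ) ≤ j := by positivity
  have h2 : (n : ℝ) * (1 / (B - 1) - 1 / (B + j - 1)) ≤ n / (2 * D) := by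
    rw [div_eq_mul_one_div (n : ℝ)]
    gcongr
    have : 0 ≤ 1 / ((B : ℝ) + j - 1) := one_div_nonneg.2 (by linarith)
    have : 1 / ((B : ℝ) - 1) ≤ 1 / (2 * D) := by gcongr; linarith
    linarith
  have h3 : ((2 * D : ℕ) : ℝ) * ((∑ i ∈ Finset.range j, n / (B + i) ^ 2 : ℕ) : ℝ) ≤ n := by
    calc _ ≤ ((2 * D : ℕ) : ℝ) * (n / (2 * D)) := by gcongr; exact h1.trans h2
      _ = n := by push_cast; field_simp
  have h4 : 2 * D * j ≤ n := by
    calc 2 * D * j ≤ k * k := by gcongr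
      _ = k ^ 2 := by ring
      _ ≤ k ^ 16 := Nat.pow_le_pow_right (by omega) (by norm_num)
      _ ≤ n := hk
  have h5 : 2 * D * ∑ i ∈ Finset.range j, n / (B + i) ^ 2 ≤ n := by exact_mod_cast h3
  omega

theorem sum_errors_le (hn : 0 < n) {D j k : ℕ} (hDk : 6 * D ≤ k) (hjk : j ≤ k) (hk1 : 1 ≤ k)
    (hk : k ^ 16 ≤ n) : (j : ℝ) * (2 * D * (3 / √n)) ≤ 1 / √√n := by
  have hn' : (0 : ℝ) < n := by positivity
  have hkn : (k : ℝ) ^ 16 ≤ n := by exact_mod_cast hk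
  have hk8 : (k : ℝ) ^ 4 ≤ √√n := by
    refine Real.le_sqrt_of_sq_le (Real.le_sqrt_of_sq_le ?_)
    rw [← pow_mul, ← pow_mul]
    exact hkn
  have h1 : √(n : ℝ) = √√n * √√n := (Real.mul_self_sqrt (Real.sqrt_nonneg _)).symm
  have h2 : (j : ℝ) * (6 * D) ≤ √√n := by
    have h3 : j * (6 * D) ≤ k ^ 4 := by
      calc j * (6 * D) ≤ k * k := by gcongr
        _ = k ^ 2 := by ring
        _ ≤ k ^ 4 := Nat.pow_le_pow_right hk1 (by norm_num)
    exact le_trans (by exact_mod_cast h3) hk8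
  calc (j : ℝ) * (2 * D * (3 / √n)) = j * (6 * D) / √n := by ring
    _ ≤ √√n / (√√n * √√n) := by rw [← h1]; gcongr
    _ = 1 / √√n := by field_simp

/-- When few vertices are unfinished, Builder finishes in `2 * n` rounds. -/
theorem Wins.finish (hn : 0 < n) {H G K : SimpleGraph (Fin n)} {D : ℕ} (hD : 1 ≤ D)
    {S : Finset (Fin n)} (hemb : Embeds H G K D S)
    (hS : S.card * (64 * (D + 1) ^ 2) ^ (16 * D) ≤ n) :
    Wins H (2 * n) (1 - 1 / √√n) G := by
  have hex : ∃ k, n < (k + 1) ^ 16 :=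
    ⟨n, (Nat.lt_succ_self n).trans_le (Nat.le_self_pow (by norm_num) _)⟩
  obtain ⟨k, hk, hk'⟩ : ∃ k, n < (k + 1) ^ 16 ∧ k ^ 16 ≤ n := by
    classical
    refine ⟨Nat.find hex, Nat.find_spec hex, ?_⟩
    rcases h : Nat.find hex with _ | m
    · simp
    · exact not_lt.1 (Nat.find_min hex (m := m) (by omega))
  obtain ⟨B, hB⟩ : ∃ B, B = 64 * (D + 1) ^ 2 := ⟨_, rfl⟩
  rw [← hB] at hS
  have hDB : 256 * D ≤ B := by nlinarith
  have hn' : (0 : ℝ) < n := by positivity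
  have hsq : (0 : ℝ) < √√n := by positivity
  rcases lt_or_ge k B with hkB | hkB
  · have h := Wins.repair_chain hn (H := H) hD 0 B hB.ge (by
      calc n < (k + 1) ^ 16 := hk
        _ ≤ B ^ 16 := by gcongr; omega
        _ ≤ _ := Nat.pow_le_pow_right (by omega) (by omega))
    refine (Wins.mono_rounds hn ?_ (Nat.zero_le _) fun G' hG' => by
      simpa using h G' K S (hemb.mono hG') hS).mono_prob (q := 1) ?_
    · rfl
    · have : 0 ≤ 1 / √√(n : ℝ) := by positivity
      linarith
  · obtain ⟨j, hj⟩ : ∃ j, j + B = k + 1 := ⟨k + 1 - B, by omega⟩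
    have hjk : j ≤ k := by omega
    have h := Wins.repair_chain hn (H := H) hD j B hB.ge (by
      rw [add_comm, hj]
      exact hk.trans_le (Nat.pow_le_pow_right (by omega) (by omega)))
    have herr := sum_errors_le hn (by omega : 6 * D ≤ k) hjk (by omega) hk'
    have htime := sum_rounds_le hD hDB (by omega : 2 * D ≤ k) hjk hk'
    have h0 : 0 ≤ (j : ℝ) * (2 * D * (3 / √n)) := by positivity
    exact (Wins.mono_rounds hn (by linarith) htime fun G' hG' =>
      h G' K S (hemb.mono hG') hS).mono_prob (by linarith)

end Finish

section FastRepair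

variable {n : ℕ}

theorem IsPool.mono {K : SimpleGraph (Fin n)} {S X X' : Finset (Fin n)} {p : ℕ}
    {y : Fin n → ℕ → Fin n} (h : IsPool K S X p y) (hX : X' ⊆ X) : IsPool K S X' p y :=
  ⟨fun x hx => h.far x (hX hx), fun x hx i hi x' hx' => h.far' x (hX hx) i hi x' (hX hx')⟩

theorem IsPool.eq_of_eq {K : SimpleGraph (Fin n)} {S X : Finset (Fin n)} {p : ℕ}
    {y : Fin n → ℕ → Fin n} (h : IsPool K S X p y) {x x' : Fin n} {i i' : ℕ} (hx : x ∈ X)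
    (hi : i < p) (hx' : x' ∈ X) (hi' : i' < p) (he : y x i = y x' i') : x = x' ∧ i = i' := by
  by_contra hne
  exact (h.far' x hx i hi x' hx' i' hi' fun h' => hne (by simpa using h')).1 he

theorem IsPool.eq_of_adj {K : SimpleGraph (Fin n)} {S X : Finset (Fin n)} {p : ℕ}
    {y : Fin n → ℕ → Fin n} (h : IsPool K S X p y) {x x' w : Fin n} {i i' : ℕ} (hx : x ∈ X)
    (hi : i < p) (hx' : x' ∈ X) (hi' : i' < p) (ha : K.Adj (y x i) w) (ha' : K.Adj (y x' i') w) :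
    x = x' ∧ i = i' := by
  by_contra hne
  exact (h.far' x hx i hi x' hx' i' hi' fun h' => hne (by simpa using h')).2.2 w ha ha'

/-- The spare vertices of the pools belonging to the neighbours of `u` in `X`. -/
noncomputable def poolNbrs (K : SimpleGraph (Fin n)) (X : Finset (Fin n)) (p : ℕ)
    (y : Fin n → ℕ → Fin n) (u : Fin n) : Finset (Fin n) :=
  (nbrs K u ∩ X).biUnion fun x => (Finset.range p).image (y x)

theorem card_poolNbrs_le {K : SimpleGraph (Fin n)} {X : Finset (Fin n)} {p r : ℕ}
    {y : Fin n → ℕ → Fin n} {u : Fin n} (hu : (nbrs K u ∩ X).card ≤ r) :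
    (poolNbrs K X p y u).card ≤ r * p := by
  refine (Finset.card_biUnion_le_card_mul _ _ p fun x _ => ?_).trans (Nat.mul_le_mul_right _ hu)
  exact Finset.card_image_le.trans_eq (Finset.card_range p)

theorem mem_poolNbrs {K : SimpleGraph (Fin n)} {X : Finset (Fin n)} {p i : ℕ}
    {y : Fin n → ℕ → Fin n} {u x : Fin n} (hx : x ∈ X) (hu : K.Adj u x) (hi : i < p) :
    y x i ∈ poolNbrs K X p y u :=
  Finset.mem_biUnion.2 ⟨x, by simp [hu, hx], Finset.mem_image_of_mem _ (by simpa using hi)⟩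

/-- The second half of the fast repair: the spare vertices claim their missing edges. -/
theorem Wins.claim_pool (hn : 0 < n) {H G K : SimpleGraph (Fin n)} {D T t m k r p : ℕ}
    {q ρ P : ℝ} {S X Z : Finset (Fin n)} (hemb : Embeds H G K D S) (hX : X ⊆ S)
    {y : Fin n → ℕ → Fin n} (hy : IsPool K S X p y)
    (hr : ∀ x ∈ X, (nbrs K x ∩ X).card ≤ r) (hk : 0 < k) (hm : k + r * p ≤ m)
    (hZ : ∀ x ∈ X, (nbrs K x ∩ Z).card ≤ k)
    (hZadj : ∀ x ∈ X, ∀ z, K.Adj x z → z ∉ Z → ∀ i < p, G.Adj (y x i) z)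
    (Q : Fin n → Finset ℕ) (hQp : ∀ x ∈ X, ∀ i ∈ Q x, i < p) (hQ : ∀ x ∈ X, k ≤ (Q x).card)
    (hQadj : ∀ x ∈ X, ∀ i ∈ Q x, ∀ w, K.Adj (y x i) w → G.Adj x w)
    (hq0 : 0 ≤ q) (hq : LowBound n T m q) (hρ : 0 ≤ ρ) (hρ6 : ρ ≤ 1 / 6)
    (hqρ : p.choose k * q ^ k ≤ ρ ^ 2) (hP : P ≤ 1)
    (h : ∀ X' ⊆ X, (X.card : ℝ) ≤ X'.card + ρ * n → ∀ G' K', Embeds H G' K' D (S \ X') →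
      Wins H t P G') :
    Wins H (T + t) (P - 3 / √n) G := by
  classical
  have hE := offerProb_card_low_le hn hq0 hq hk hρ hρ6 hqρ X (fun x => (Q x).image (y x)) (d := 1)
    (fun x hx => by
      refine Finset.card_image_le.trans ?_
      refine (Finset.card_le_card (t := Finset.range p) fun i hi => ?_).trans_eq
        (Finset.card_range p)
      simpa using hQp x hx i hi)
    (fun x hx => by
      refine Finset.card_le_one.2 ?_
      have key : ∀ x' ∈ X.filter fun j => ¬ Disjoint ((Q x).image (y x)) ((Q j).image (y j)),
          x = x' := by
        intro x' hx'
        obtain ⟨hx', hd⟩ := Finset.mem_filter.1 hx'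
        obtain ⟨v, hv, hv'⟩ := Finset.not_disjoint_iff.1 hd
        obtain ⟨i, hi, rfl⟩ := Finset.mem_image.1 hv
        obtain ⟨i', hi', hii⟩ := Finset.mem_image.1 hv'
        exact (hy.eq_of_eq hx (hQp x hx i hi) hx' (hQp x' hx' i' hi') hii.symm).1
      exact fun a ha b hb => (key a ha).symm.trans (key b hb))
  let A : Fin n → Finset (Fin n) := fun u =>
    if h : ∃ x ∈ X, ∃ i < p, y x i = u then (nbrs K h.choose ∩ Z) ∪ poolNbrs K X p y h.choose
    else ∅
  have hA : ∀ x ∈ X, ∀ i < p, A (y x i) = (nbrs K x ∩ Z) ∪ poolNbrs K X p y x := by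
    intro x hx i hi
    have h : ∃ x' ∈ X, ∃ i' < p, y x' i' = y x i := ⟨x, hx, i, hi, rfl⟩
    obtain ⟨hx', i', hi', he⟩ := h.choose_spec
    have hc : h.choose = x := (hy.eq_of_eq hx' hi' hx hi he).1
    simp only [A, dif_pos h, hc]
  refine Wins.of_targets hn A _ hE hP fun l hl hEl G' hG' hadj => ?_
  rw [not_lt] at hEl
  set F := X.filter fun x => k ≤ (((Q x).image (y x)).filter fun v => l.count v < m).card with hF
  have hgood : ∀ x, ∃ i, x ∈ X \ F → i ∈ Q x ∧ m ≤ l.count (y x i) := by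
    intro x
    by_cases hx : x ∈ X \ F
    · obtain ⟨hx, hxF⟩ := Finset.mem_sdiff.1 hx
      have h1 : (((Q x).image (y x)).filter fun v => l.count v < m).card < k := by
        by_contra hc
        exact hxF (Finset.mem_filter.2 ⟨hx, not_lt.1 hc⟩)
      have h2 : ((Q x).image (y x)).card = (Q x).card := Finset.card_image_of_injOn
        fun i hi i' hi' he => (hy.eq_of_eq hx (hQp x hx i hi) hx (hQp x hx i' hi') he).2
      obtain ⟨v, hv, hv'⟩ := Finset.exists_mem_notMem_of_card_lt_card
        (h1.trans_le ((hQ x hx).trans_eq h2.symm))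
      obtain ⟨i, hi, rfl⟩ := Finset.mem_image.1 hv
      refine ⟨i, fun _ => ⟨hi, ?_⟩⟩
      by_contra hc
      exact hv' (Finset.mem_filter.2 ⟨hv, not_le.1 hc⟩)
    · exact ⟨0, fun h => absurd h hx⟩
  choose ι hι using hgood
  have hXF : X \ F ⊆ X := Finset.sdiff_subset
  have hιp : ∀ x ∈ X \ F, ι x < p := fun x hx => hQp x (hXF hx) _ (hι x hx).1
  have hfar : ∀ x ∈ X \ F, ∀ v ∈ S, Far K v (y x (ι x)) := fun x hx =>
    hy.far x (hXF hx) _ (hιp x hx)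
  have hfar' : ∀ x ∈ X \ F, ∀ x' ∈ X \ F, x ≠ x' → Far K (y x (ι x)) (y x' (ι x')) :=
    fun x hx x' hx' hne => hy.far' x (hXF hx) _ (hιp x hx) x' (hXF hx') _ (hιp x' hx')
      fun he => hne (congrArg Prod.fst he)
  have hclaim : ∀ x ∈ X \ F, ∀ v ∈ (nbrs K x ∩ Z) ∪ poolNbrs K X p y x, v ≠ y x (ι x) →
      G'.Adj (y x (ι x)) v := by
    intro x hx v hv hne
    refine hadj _ ?_ v ?_ hne
    · rw [hA x (hXF hx) _ (hιp x hx)]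
      refine le_trans ?_ (hι x hx).2
      exact (Finset.card_union_le _ _).trans
        ((add_le_add (hZ x (hXF hx)) (card_poolNbrs_le (hr x (hXF hx)))).trans hm)
    · rwa [hA x (hXF hx) _ (hιp x hx)]
  obtain ⟨K', hK'⟩ := (hemb.mono hG').swap (hXF.trans hX) (fun x => y x (ι x))
    (fun x hx x' hx' he => (hy.eq_of_eq (hXF hx) (hιp x hx) (hXF hx') (hιp x' hx') he).1)
    (fun x hx hxS => (hfar x hx _ hxS).1 rfl)
    (fun x hx v hv hadj => (hfar x hx v hv).2.1 hadj.symm)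
    (fun x hx x' hx' hadj => by
      rcases eq_or_ne x x' with rfl | hne
      · exact K.irrefl hadj
      · exact (hfar' x hx x' hx' hne).2.1 hadj)
    (fun x hx z hz hxz => by
      by_cases hzZ : z ∈ Z
      · refine hclaim x hx z (Finset.mem_union_left _ (by simp [hxz, hzZ])) fun he => ?_
        exact (hfar x hx x (hX (hXF hx))).2.1 (he ▸ hxz)
      · exact hG' (hZadj x (hXF hx) z hxz hzZ _ (hιp x hx)))
    (fun x hx x' hx' hadj => by
      refine hclaim x hx _
        (Finset.mem_union_right _ (mem_poolNbrs (hXF hx') hadj (hιp x' hx'))) fun he => ?_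
      exact hadj.ne' (hy.eq_of_eq (hXF hx') (hιp x' hx') (hXF hx) (hιp x hx) he).1)
    (fun x hx w hw => hG' (hQadj x (hXF hx) _ (hι x hx).1 w hw))
  refine h _ hXF ?_ G' K' hK'
  have h1 : X.card ≤ (X \ F).card + F.card := by
    have := Finset.le_card_sdiff F X; omega
  have h2 : (X.card : ℝ) ≤ (X \ F).card + F.card := by exact_mod_cast h1
  simp only [Nat.cast_one, one_mul] at hEl
  linarith

/-- Builder repairs almost all vertices of `X` in `2 * T` rounds. -/
theorem Wins.fast_repair (hn : 0 < n) {H G K : SimpleGraph (Fin n)} {D T t m k r : ℕ}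
    {q ρ P : ℝ} {S X : Finset (Fin n)} (hD : 1 ≤ D) (hemb : Embeds H G K D S) (hX : X ⊆ S)
    {y : Fin n → ℕ → Fin n} (hy : IsPool K S X (2 * k) y)
    (hr : ∀ x ∈ X, (nbrs K x ∩ X).card ≤ r)
    (hr' : ∀ x ∈ X, ∀ z, K.Adj x z → (nbrs K z ∩ X).card ≤ r) (hk : 0 < k)
    (hm : k + r * (2 * k) ≤ m) (hq0 : 0 ≤ q) (hq : LowBound n T m q) (hρ : 0 ≤ ρ)
    (hρ6 : ρ ≤ 1 / 6) (hqρ : (D * (2 * k + 1)).choose k * q ^ k ≤ ρ ^ 2) (hP : P ≤ 1)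
    (h : ∀ X' ⊆ X, (X.card : ℝ) ≤ X'.card + (D * D + 2) * (ρ * n) → ∀ G' K',
      Embeds H G' K' D (S \ X') → Wins H t P G') :
    Wins H (T + (T + t)) (P - 3 / √n - 3 / √n) G := by
  classical
  set Y : Fin n → Finset (Fin n) := fun x =>
    (Finset.range (2 * k)).biUnion fun i => nbrs K (y x i) with hY
  have hmemY : ∀ x w, w ∈ Y x ↔ ∃ i < 2 * k, K.Adj (y x i) w := by
    intro x w; simp [hY]
  set W : Fin n → Finset (Fin n) := fun x => nbrs K x ∪ Y x with hW
  have hE := offerProb_card_low_le hn hq0 hq hk hρ hρ6 hqρ X W (d := D * D + 1)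
    (fun x hx => by
      refine (Finset.card_union_le _ _).trans ?_
      have h1 : (Y x).card ≤ 2 * k * D := by
        refine (Finset.card_biUnion_le_card_mul _ _ D fun i _ => hemb.degree _).trans_eq ?_
        rw [Finset.card_range]
      have h2 := hemb.degree x
      linarith)
    (fun x hx => by
      have hsub : (X.filter fun j => ¬ Disjoint (W x) (W j)) ⊆
          insert x ((nbrs K x).biUnion (nbrs K)) := by
        intro x' hx'
        obtain ⟨hx', hd⟩ := Finset.mem_filter.1 hx'
        obtain ⟨w, hw, hw'⟩ := Finset.not_disjoint_iff.1 hd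
        rw [Finset.mem_insert]
        rcases Finset.mem_union.1 hw with hw | hw <;> rcases Finset.mem_union.1 hw' with hw' | hw'
        · right
          exact Finset.mem_biUnion.2 ⟨w, hw, mem_nbrs.2 (mem_nbrs.1 hw').symm⟩
        · obtain ⟨i, hi, hw'⟩ := (hmemY _ _).1 hw'
          exact absurd hw' ((hy.far x' hx' i hi x (hX hx)).2.2 w (mem_nbrs.1 hw))
        · obtain ⟨i, hi, hw⟩ := (hmemY _ _).1 hw
          exact absurd hw ((hy.far x hx i hi x' (hX hx')).2.2 w (mem_nbrs.1 hw'))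
        · obtain ⟨i, hi, hw⟩ := (hmemY _ _).1 hw
          obtain ⟨i', hi', hw'⟩ := (hmemY _ _).1 hw'
          exact Or.inl (hy.eq_of_adj hx hi hx' hi' hw hw').1.symm
      refine (Finset.card_le_card hsub).trans ((Finset.card_insert_le _ _).trans ?_)
      gcongr
      exact (card_biUnion_nbrs_le hemb.degree _).trans (Nat.mul_le_mul_right _ (hemb.degree x)))
  have h3 : 0 ≤ 3 / √(n : ℝ) := by positivity
  refine Wins.of_targets hn
    (fun u => poolNbrs K X (2 * k) y u ∪ X.filter fun x => u ∈ Y x) _ hE (by linarith)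
    fun l hl hEl G' hG' hadj => ?_
  rw [not_lt] at hEl
  set F := X.filter fun x => k ≤ ((W x).filter fun v => l.count v < m).card with hF
  set Z : Finset (Fin n) := Finset.univ.filter fun v => l.count v < m with hZ
  have hXF : X \ F ⊆ X := Finset.sdiff_subset
  have hweak : ∀ x ∈ X \ F, (W x ∩ Z).card < k := by
    intro x hx
    obtain ⟨hx, hxF⟩ := Finset.mem_sdiff.1 hx
    by_contra hc
    refine hxF (Finset.mem_filter.2 ⟨hx, (not_lt.1 hc).trans_eq ?_⟩)
    congr 1
    ext v
    simp [hZ]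
  have hstrong : ∀ z, z ∉ Z → m ≤ l.count z := by
    intro z hz
    simpa [hZ] using hz
  have hmr : r * (2 * k) ≤ m := by omega
  have hcardN : ∀ x ∈ X, ∀ z, K.Adj x z →
      (poolNbrs K X (2 * k) y z ∪ X.filter fun x => z ∈ Y x).card ≤ m := by
    intro x hx z hxz
    have hempty : (X.filter fun x => z ∈ Y x) = ∅ := by
      refine Finset.filter_eq_empty_iff.2 fun x' hx' hz => ?_
      obtain ⟨i, hi, hz⟩ := (hmemY _ _).1 hz
      exact (hy.far x' hx' i hi x (hX hx)).2.2 z hxz hz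
    rw [hempty, Finset.union_empty]
    exact (card_poolNbrs_le (hr' x hx z hxz)).trans hmr
  have hcardY : ∀ x ∈ X, ∀ w ∈ Y x,
      (poolNbrs K X (2 * k) y w ∪ X.filter fun x => w ∈ Y x).card ≤ m := by
    intro x hx w hw
    obtain ⟨i, hi, hw⟩ := (hmemY _ _).1 hw
    have hempty : poolNbrs K X (2 * k) y w = ∅ := by
      have : nbrs K w ∩ X = ∅ := by
        ext v
        simp only [Finset.mem_inter, mem_nbrs, Finset.notMem_empty, iff_false, not_and]
        exact fun hv hvX => (hy.far x hx i hi v (hX hvX)).2.2 w hv.symm hw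
      rw [poolNbrs, this, Finset.biUnion_empty]
    rw [hempty, Finset.empty_union]
    refine le_trans (Finset.card_le_one.2 ?_) (by omega : 1 ≤ m)
    have key : ∀ x' ∈ X.filter fun x => w ∈ Y x, x = x' := by
      intro x' hx'
      obtain ⟨hx', hw'⟩ := Finset.mem_filter.1 hx'
      obtain ⟨i', hi', hw'⟩ := (hmemY _ _).1 hw'
      exact (hy.eq_of_adj hx hi hx' hi' hw hw').1
    exact fun a ha b hb => (key a ha).symm.trans (key b hb)
  refine Wins.claim_pool hn (hemb.mono hG') (hXF.trans hX) (hy.mono hXF) (Z := Z) (m := m) (k := k)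
    (r := r) (fun x hx => le_trans (Finset.card_le_card ?_) (hr x (hXF hx))) hk hm
    (fun x hx => le_trans (Finset.card_le_card ?_) (hweak x hx).le) ?_
    (fun x => (Finset.range (2 * k)).filter fun i => ∀ w, K.Adj (y x i) w → w ∉ Z)
    (fun x _ i hi => Finset.mem_range.1 (Finset.mem_filter.1 hi).1) ?_ ?_ hq0 hq hρ hρ6 ?_ hP ?_
  · exact Finset.inter_subset_inter_left hXF
  · exact Finset.inter_subset_inter_right Finset.subset_union_left
  · intro x hx z hxz hzZ i hi
    refine (hadj z ((hcardN x (hXF hx) z hxz).trans (hstrong z hzZ)) _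
      (Finset.mem_union_left _ (mem_poolNbrs (hXF hx) hxz.symm hi)) fun he => ?_).symm
    exact (hy.far x (hXF hx) i hi x (hX (hXF hx))).2.1 (he ▸ hxz)
  · intro x hx
    have h1 : ((Finset.range (2 * k)).filter fun i => ¬ ∀ w, K.Adj (y x i) w → w ∉ Z).card ≤
        (W x ∩ Z).card := by
      have hex : ∀ i, ∃ w, (¬ ∀ w, K.Adj (y x i) w → w ∉ Z) → K.Adj (y x i) w ∧ w ∈ Z := by
        intro i
        by_cases hi : ∀ w, K.Adj (y x i) w → w ∉ Z
        · exact ⟨x, fun h => absurd hi h⟩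
        · push Not at hi
          obtain ⟨w, hw⟩ := hi
          exact ⟨w, fun _ => hw⟩
      choose f hf using hex
      refine Finset.card_le_card_of_injOn f (fun i hi => ?_) fun i hi i' hi' he => ?_
      · obtain ⟨hi, hi'⟩ := Finset.mem_filter.1 hi
        exact Finset.mem_inter.2 ⟨Finset.mem_union_right _
          ((hmemY _ _).2 ⟨i, Finset.mem_range.1 hi, (hf i hi').1⟩), (hf i hi').2⟩
      · obtain ⟨hi, hi1⟩ := Finset.mem_filter.1 hi
        obtain ⟨hi', hi1'⟩ := Finset.mem_filter.1 hi'
        exact (hy.eq_of_adj (hXF hx) (Finset.mem_range.1 hi) (hXF hx) (Finset.mem_range.1 hi')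
          (hf i hi1).1 (he ▸ (hf i' hi1').1)).2
    have h2 := Finset.card_filter_add_card_filter_not (s := Finset.range (2 * k))
      fun i => ∀ w, K.Adj (y x i) w → w ∉ Z
    rw [Finset.card_range] at h2
    have h4 := hweak x hx
    omega
  · intro x hx i hi w hw
    obtain ⟨hi, hi'⟩ := Finset.mem_filter.1 hi
    have hwY : w ∈ Y x := (hmemY _ _).2 ⟨i, Finset.mem_range.1 hi, hw⟩
    refine (hadj w ((hcardY x (hXF hx) w hwY).trans (hstrong w (hi' w hw))) x
      (Finset.mem_union_right _ (Finset.mem_filter.2 ⟨hXF hx, hwY⟩)) fun he => ?_).symm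
    exact (hy.far x (hXF hx) i (Finset.mem_range.1 hi) x (hX (hXF hx))).2.1
      (he.symm ▸ hw : K.Adj (y x i) x).symm
  · refine le_trans ?_ hqρ
    refine mul_le_mul_of_nonneg_right (Nat.cast_le.2 (Nat.choose_le_choose _ ?_)) (pow_nonneg hq0 _)
    exact (Nat.le_succ _).trans (Nat.le_mul_of_pos_left _ hD)
  · intro X' hX' hcard G'' K' hK'
    refine h X' (hX'.trans hXF) ?_ G'' K' hK'
    have h1 : X.card ≤ (X \ F).card + F.card := by
      have := Finset.le_card_sdiff F X; omega
    have h2 : (X.card : ℝ) ≤ (X \ F).card + F.card := by exact_mod_cast h1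
    push_cast at hEl
    linarith

end FastRepair

section Assembly

variable {n : ℕ}

/-- The density of vertices left unfinished by the fast repair. -/
noncomputable def leftover (L : ℕ) : ℝ := Real.exp (-((L : ℝ) ^ 12 / 16))

theorem cast_pow_le_exp (L k : ℕ) : (L : ℝ) ^ k ≤ Real.exp (k * L) := by
  rw [Real.exp_nat_mul]
  gcongr
  linarith [Real.add_one_le_exp (L : ℝ)]

theorem leftover_le {L : ℕ} (hL : 10000 ≤ L) : leftover L ≤ 1 / 6 := by
  have hL' : (10000 : ℝ) ≤ L := by exact_mod_cast hL
  have h1 : (L : ℝ) ≤ L ^ 12 := le_self_pow₀ (by linarith) (by norm_num)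
  rw [leftover, Real.exp_neg, one_div]
  gcongr
  linarith [Real.add_one_le_exp ((L : ℝ) ^ 12 / 16)]

theorem leftover_sq (L : ℕ) : leftover L ^ 2 = Real.exp (-((L : ℝ) ^ 12 / 8)) := by
  rw [leftover, ← Real.exp_nat_mul]
  push_cast
  ring_nf

theorem choose_mul_exp_pow_le_exp {N k : ℕ} {a b : ℝ} (hN : (N : ℝ) ≤ Real.exp a) :
    (N.choose k : ℝ) * Real.exp (-b) ^ k ≤ Real.exp (-(k * (b - a))) := by
  calc (N.choose k : ℝ) * Real.exp (-b) ^ k ≤ (N : ℝ) ^ k * Real.exp (-b) ^ k := by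
        gcongr; exact_mod_cast Nat.choose_le_pow N k
    _ ≤ Real.exp a ^ k * Real.exp (-b) ^ k := by gcongr
    _ = _ := by rw [← mul_pow, ← Real.exp_add, ← Real.exp_nat_mul]; ring_nf

theorem choose_bound_first {L : ℕ} (hL : 10000 ≤ L) :
    ((L ^ 10).choose (L ^ 4) : ℝ) * Real.exp (-((L : ℝ) ^ 8 / 2)) ^ L ^ 4 ≤ leftover L ^ 2 := by
  have hL' : (10000 : ℝ) ≤ L := by exact_mod_cast hL
  refine (choose_mul_exp_pow_le_exp (a := 10 * L) ?_).trans ?_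
  · exact_mod_cast cast_pow_le_exp L 10
  · rw [leftover_sq]
    gcongr
    have h1 : (L : ℝ) ^ 2 ≤ L ^ 8 := pow_le_pow_right₀ (by linarith) (by norm_num)
    have h2 : (L : ℝ) ^ 8 / 8 ≤ L ^ 8 / 2 - 10 * L := by nlinarith
    push_cast
    calc (L : ℝ) ^ 12 / 8 = (L : ℝ) ^ 4 * ((L : ℝ) ^ 8 / 8) := by ring
      _ ≤ (L : ℝ) ^ 4 * ((L : ℝ) ^ 8 / 2 - 10 * L) := by gcongr

theorem choose_bound_second {L : ℕ} (hL : 10000 ≤ L) :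
    ((L ^ 10 * (2 * L ^ 3 + 1)).choose (L ^ 3) : ℝ) *
      Real.exp (-(((L ^ 9 : ℕ) : ℝ) / 4)) ^ L ^ 3 ≤ leftover L ^ 2 := by
  have hL' : (10000 : ℝ) ≤ L := by exact_mod_cast hL
  refine (choose_mul_exp_pow_le_exp (a := 14 * L) ?_).trans ?_
  · refine le_trans ?_ (by exact_mod_cast cast_pow_le_exp L 14)
    push_cast
    have h1 : (1 : ℝ) ≤ L ^ 3 := one_le_pow₀ (by linarith)
    calc (L : ℝ) ^ 10 * (2 * (L : ℝ) ^ 3 + 1) ≤ (L : ℝ) ^ 10 * (L * (L : ℝ) ^ 3) := by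
          gcongr; nlinarith
      _ = (L : ℝ) ^ 14 := by ring
  · rw [leftover_sq]
    gcongr
    have h1 : (L : ℝ) ^ 2 ≤ L ^ 9 := pow_le_pow_right₀ (by linarith) (by norm_num)
    have h2 : (L : ℝ) ^ 9 / 8 ≤ L ^ 9 / 4 - 14 * L := by nlinarith
    push_cast
    calc (L : ℝ) ^ 12 / 8 = (L : ℝ) ^ 3 * ((L : ℝ) ^ 9 / 8) := by ring
      _ ≤ (L : ℝ) ^ 3 * ((L : ℝ) ^ 9 / 4 - 14 * L) := by gcongr

theorem pool_bound {L : ℕ} (hL : 10000 ≤ L) :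
    Real.exp (-((L : ℝ) ^ 8 / 4)) *
      ((2 * L ^ 3 + 1) * (1 + L ^ 10 + L ^ 10 * L ^ 10)) ≤ 1 := by
  have hL' : (10000 : ℝ) ≤ L := by exact_mod_cast hL
  have h3 : (1 : ℝ) ≤ L ^ 3 := one_le_pow₀ (by linarith)
  have h10 : (1 : ℝ) ≤ L ^ 10 := one_le_pow₀ (by linarith)
  have hb : (2 * (L : ℝ) ^ 3 + 1) * (1 + L ^ 10 + L ^ 10 * L ^ 10) ≤ Real.exp (25 * L) := by
    calc (2 * (L : ℝ) ^ 3 + 1) * (1 + L ^ 10 + L ^ 10 * L ^ 10)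
        ≤ (L * L ^ 3) * (L * (L ^ 10 * L ^ 10)) := by gcongr <;> nlinarith
      _ = (L : ℝ) ^ 25 := by ring
      _ ≤ Real.exp (25 * L) := by exact_mod_cast cast_pow_le_exp L 25
  have h2 : (L : ℝ) ^ 2 ≤ L ^ 8 := pow_le_pow_right₀ (by linarith) (by norm_num)
  calc _ ≤ Real.exp (-((L : ℝ) ^ 8 / 4)) * Real.exp (25 * L) := by gcongr
    _ = Real.exp (-((L : ℝ) ^ 8 / 4) + 25 * L) := by rw [Real.exp_add]
    _ ≤ 1 := Real.exp_le_one_iff.2 (by nlinarith)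

theorem leftover_bound {L D : ℕ} (hL : 10000 ≤ L) (hD : D = L ^ 10) :
    ((D : ℝ) + 2) * (D * D + 2) * leftover L * (64 * (D + 1) ^ 2) ^ (16 * D) ≤ 1 := by
  have hL' : (10000 : ℝ) ≤ L := by exact_mod_cast hL
  have h10 : (1 : ℝ) ≤ L ^ 10 := one_le_pow₀ (by linarith)
  have hD' : (D : ℝ) = L ^ 10 := by rw [hD]; push_cast; rfl
  have h1 : (D : ℝ) + 2 ≤ Real.exp (11 * L) := by
    calc (D : ℝ) + 2 ≤ L * L ^ 10 := by rw [hD']; nlinarith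
      _ = (L : ℝ) ^ 11 := by ring
      _ ≤ _ := by exact_mod_cast cast_pow_le_exp L 11
  have h2 : (D : ℝ) * D + 2 ≤ Real.exp (21 * L) := by
    calc (D : ℝ) * D + 2 ≤ L * (L ^ 10 * L ^ 10) := by rw [hD']; nlinarith
      _ = (L : ℝ) ^ 21 := by ring
      _ ≤ _ := by exact_mod_cast cast_pow_le_exp L 21
  have h3 : 64 * ((D : ℝ) + 1) ^ 2 ≤ Real.exp (22 * L) := by
    calc 64 * ((D : ℝ) + 1) ^ 2 ≤ 64 * (2 * (L : ℝ) ^ 10) ^ 2 := by gcongr; linarith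
      _ = 256 * ((L : ℝ) ^ 10) ^ 2 := by ring
      _ ≤ (L : ℝ) ^ 2 * ((L : ℝ) ^ 10) ^ 2 := by gcongr; nlinarith
      _ = (L : ℝ) ^ 22 := by ring
      _ ≤ _ := by exact_mod_cast cast_pow_le_exp L 22
  have hL11 : (L : ℝ) ≤ L ^ 11 := le_self_pow₀ (by linarith) (by norm_num)
  calc _ ≤ Real.exp (11 * L) * Real.exp (21 * L) * Real.exp (-((L : ℝ) ^ 12 / 16)) *
        Real.exp (22 * L) ^ (16 * D) := by rw [leftover]; gcongr
    _ = Real.exp (32 * L + 352 * L ^ 11 - L ^ 12 / 16) := by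
        rw [← Real.exp_nat_mul, ← Real.exp_add, ← Real.exp_add, ← Real.exp_add]
        push_cast
        rw [hD']
        ring_nf
    _ ≤ 1 := Real.exp_le_one_iff.2 (by nlinarith)

theorem eight_mul_bound {L : ℕ} (hL : 10000 ≤ L) : 8 * (L ^ 3 + L ^ 4 * (2 * L ^ 3)) ≤ L ^ 9 := by
  have h1 : L ^ 3 ≤ L ^ 7 := Nat.pow_le_pow_right (by omega) (by norm_num)
  calc 8 * (L ^ 3 + L ^ 4 * (2 * L ^ 3)) = 8 * L ^ 3 + 16 * L ^ 7 := by ring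
    _ ≤ (10000 * 10000) * L ^ 7 := by omega
    _ ≤ (L * L) * L ^ 7 := by gcongr
    _ = L ^ 9 := by ring

/-- Builder wins in `(1 + o(1)) * L ^ 10 * n / 2` rounds, for maximum degree at most `L ^ 10`. -/
theorem wins_of_degree_le (hn : 0 < n) {H : SimpleGraph (Fin n)} {L m : ℕ} (hL : 10000 ≤ L)
    (hm : 2 * m = L ^ 10) (hdeg : ∀ u, (nbrs H u).card ≤ L ^ 10) (G : SimpleGraph (Fin n)) :
    Wins H ((m + L ^ 9) * n + (L ^ 9 * n + (L ^ 9 * n + 2 * n)))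
      (1 - 1 / √√n - 3 / √n - 3 / √n - (3 / √n + 3 / √n)) G := by
  classical
  obtain ⟨D, hD⟩ : ∃ D, D = L ^ 10 := ⟨_, rfl⟩
  rw [← hD] at hdeg
  have hD1 : 1 ≤ D := hD ▸ Nat.one_le_pow _ _ (by omega)
  have hL' : (10000 : ℝ) ≤ L := by exact_mod_cast hL
  obtain ⟨A, hA, hAadj⟩ := exists_orientation (K := H) (m := m) (by rwa [hm, ← hD])
  have hlow := lowBound_of_excess hn (by omega : 2 ≤ L) hm
  have hρ0 : 0 ≤ leftover L := (Real.exp_pos _).le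
  have h8 : (L : ℝ) ≤ L ^ 8 := le_self_pow₀ (by linarith) (by norm_num)
  have hE1 := offerProb_card_low_le hn (Real.exp_pos _).le hlow (ℓ := 1) (w := 1) (d := 1)
    (r := Real.exp (-((L : ℝ) ^ 8 / 4))) one_pos (Real.exp_pos _).le (by
      rw [Real.exp_neg, one_div]
      gcongr
      linarith [Real.add_one_le_exp ((L : ℝ) ^ 8 / 4)]) (by
      simp only [Nat.choose_self, Nat.cast_one, one_mul, pow_one]
      rw [← Real.exp_nat_mul]
      refine Real.exp_le_exp.2 ?_
      push_cast
      linarith) Finset.univ (fun u => {u}) (by simp) (fun u _ => by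
      refine Finset.card_le_one.2 fun a ha b hb => ?_
      simp only [Finset.mem_filter, Finset.mem_univ, true_and, Finset.disjoint_singleton,
        not_not] at ha hb
      exact ha.symm.trans hb)
  have hE2 := offerProb_card_low_le hn (Real.exp_pos _).le hlow (ℓ := L ^ 4) (w := L ^ 10)
    (d := D * D + 1) (r := leftover L) (by positivity) hρ0 (leftover_le hL)
    (choose_bound_first hL) Finset.univ (nbrs H) (fun u _ => hD ▸ hdeg u) (fun u _ => by
      have hsub : (Finset.univ.filter fun j => ¬ Disjoint (nbrs H u) (nbrs H j)) ⊆
          (nbrs H u).biUnion (nbrs H) := by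
        intro v hv
        obtain ⟨w, hw, hw'⟩ := Finset.not_disjoint_iff.1 (Finset.mem_filter.1 hv).2
        exact Finset.mem_biUnion.2 ⟨w, hw, mem_nbrs.2 (mem_nbrs.1 hw').symm⟩
      refine (Finset.card_le_card hsub).trans ?_
      refine (card_biUnion_nbrs_le hdeg _).trans ((Nat.mul_le_mul_right _ (hdeg u)).trans ?_)
      omega)
  have h3 : 0 ≤ 3 / √(n : ℝ) := by positivity
  have h4 : 0 ≤ 1 / √√(n : ℝ) := by positivity
  have hn' : (0 : ℝ) < n := by positivity
  refine Wins.of_targets hn A _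
    ((offerProb_or_le _ _ _).trans (add_le_add hE1 hE2)) (by linarith)
    fun l hl hEl G' hG' hadj => ?_
  rw [not_or, not_lt, not_lt] at hEl
  obtain ⟨hEl1, hEl2⟩ := hEl
  set S : Finset (Fin n) := Finset.univ.filter fun u => l.count u < m with hS
  set Z : Finset (Fin n) := Finset.univ.filter fun z => L ^ 4 ≤ (nbrs H z ∩ S).card with hZ
  have hScard : (S.card : ℝ) ≤ Real.exp (-((L : ℝ) ^ 8 / 4)) * n := by
    refine le_trans (Nat.cast_le.2 (Finset.card_le_card fun u hu => ?_)) (by simpa using hEl1)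
    have hu' : l.count u < m := (Finset.mem_filter.1 hu).2
    simp [Finset.filter_singleton, hu']
  have hZcard : (Z.card : ℝ) ≤ (D * D + 1) * (leftover L * n) := by
    refine le_trans (Nat.cast_le.2 (Finset.card_le_card fun z hz => ?_)) (by exact_mod_cast hEl2)
    refine Finset.mem_filter.2 ⟨Finset.mem_univ _, ?_⟩
    refine ((Finset.mem_filter.1 hz).2).trans_eq ?_
    congr 1
    ext v
    simp [hS]
  have hemb : Embeds H G' H D S := by
    refine ⟨⟨id, Function.injective_id, fun u v h => h⟩, hdeg, fun u v huv hu hv => ?_⟩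
    have hc : ∀ u, u ∉ S → (A u).card ≤ l.count u := fun u hu =>
      (hA u).trans (by simpa [hS] using hu)
    rcases hAadj u v huv with h | h
    · exact hadj u (hc u hu) v h huv.ne'
    · exact (hadj v (hc v hv) u h huv.ne).symm
  set X := S.filter fun x => x ∉ Z ∧ ∀ z, H.Adj x z → z ∉ Z with hX
  have hXS : X ⊆ S := Finset.filter_subset _ _
  have hXZ : ∀ z, z ∉ Z → (nbrs H z ∩ X).card ≤ L ^ 4 := by
    intro z hz
    refine (Finset.card_le_card (Finset.inter_subset_inter_left hXS)).trans ?_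
    by_contra hc
    exact hz (Finset.mem_filter.2 ⟨Finset.mem_univ _, (not_le.1 hc).le⟩)
  have hSX : (S \ X).card ≤ (D + 1) * Z.card := by
    have hsub : S \ X ⊆ Z ∪ Z.biUnion (nbrs H) := by
      intro x hx
      obtain ⟨hx, hxX⟩ := Finset.mem_sdiff.1 hx
      by_contra hc
      simp only [Finset.mem_union, Finset.mem_biUnion, mem_nbrs, not_or, not_exists, not_and] at hc
      exact hxX (Finset.mem_filter.2 ⟨hx, hc.1, fun z hxz hz => hc.2 z hz hxz.symm⟩)
    refine (Finset.card_le_card hsub).trans ((Finset.card_union_le _ _).trans ?_)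
    have := card_biUnion_nbrs_le hdeg Z
    linarith
  obtain ⟨y, hy⟩ := exists_isPool hdeg S X hXS (2 * L ^ 3) <| by
    have h1 : (S.card : ℝ) * ((2 * L ^ 3 + 1) * (1 + L ^ 10 + L ^ 10 * L ^ 10)) ≤ n := by
      calc _ ≤ Real.exp (-((L : ℝ) ^ 8 / 4)) * n *
            ((2 * L ^ 3 + 1) * (1 + L ^ 10 + L ^ 10 * L ^ 10)) := by gcongr
        _ = n * (Real.exp (-((L : ℝ) ^ 8 / 4)) *
            ((2 * L ^ 3 + 1) * (1 + L ^ 10 + L ^ 10 * L ^ 10))) := by ring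
        _ ≤ n * 1 := by gcongr; exact pool_bound hL
        _ = n := mul_one _
    rw [hD, mul_assoc]
    exact_mod_cast h1
  refine Wins.fast_repair hn hD1 hemb hXS hy (fun x hx => hXZ x (Finset.mem_filter.1 hx).2.1)
    (fun x hx z hxz => hXZ z ((Finset.mem_filter.1 hx).2.2 z hxz)) (by positivity) le_rfl
    (Real.exp_pos _).le (lowBound_of_eight_mul_le hn (eight_mul_bound hL)) hρ0 (leftover_le hL)
    (hD ▸ choose_bound_second hL) (by linarith) fun X' hX' hcard G'' K' hK' => ?_
  refine Wins.finish hn hD1 hK' ?_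
  have hcS : ((S \ X').card : ℝ) ≤ (D + 2) * (D * D + 2) * leftover L * n := by
    have h1 : ((S \ X).card : ℝ) ≤ (D + 1) * ((D * D + 1) * (leftover L * n)) := by
      calc ((S \ X).card : ℝ) ≤ (D + 1) * Z.card := by exact_mod_cast hSX
        _ ≤ _ := by gcongr
    have h2 : ((S \ X').card : ℝ) = (S \ X).card + (X.card - X'.card) := by
      rw [Finset.card_sdiff_of_subset hXS, Finset.card_sdiff_of_subset (hX'.trans hXS),
        Nat.cast_sub (Finset.card_le_card hXS), Nat.cast_sub (Finset.card_le_card (hX'.trans hXS))]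
      ring
    have h5 : 0 ≤ leftover L * n := by positivity
    have h6 : 0 ≤ (D : ℝ) * (leftover L * n) := by positivity
    nlinarith
  have : ((S \ X').card : ℝ) * (64 * (D + 1) ^ 2) ^ (16 * D) ≤ n := by
    calc _ ≤ (D + 2) * (D * D + 2) * leftover L * n * (64 * ((D : ℝ) + 1) ^ 2) ^ (16 * D) := by
          gcongr
      _ = n * ((D + 2) * (D * D + 2) * leftover L * (64 * ((D : ℝ) + 1) ^ 2) ^ (16 * D)) := by ring
      _ ≤ n * 1 := by gcongr; exact leftover_bound hL hD
      _ = n := mul_one _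
  exact_mod_cast this

end Assembly

section Rounds

theorem exists_le_two_mul_pow (D : ℕ) : ∃ k, 5000 ≤ k ∧ D ≤ (2 * k) ^ 10 := by
  refine ⟨max 5000 D, le_max_left _ _, ?_⟩
  calc D ≤ 2 * max 5000 D := by omega
    _ ≤ (2 * max 5000 D) ^ 10 := Nat.le_self_pow (by norm_num) _

open Classical in
/-- The least even number at least `10000` whose tenth power is at least `D`. -/
noncomputable def evenRoot (D : ℕ) : ℕ := 2 * Nat.find (exists_le_two_mul_pow D)

theorem le_evenRoot (D : ℕ) : 10000 ≤ evenRoot D := by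
  classical
  have := (Nat.find_spec (exists_le_two_mul_pow D)).1
  rw [evenRoot]
  omega

theorem le_evenRoot_pow (D : ℕ) : D ≤ evenRoot D ^ 10 := by
  classical
  exact (Nat.find_spec (exists_le_two_mul_pow D)).2

theorem exists_two_mul_eq_evenRoot_pow (D : ℕ) : ∃ m, 2 * m = evenRoot D ^ 10 := by
  classical
  exact ⟨2 ^ 9 * Nat.find (exists_le_two_mul_pow D) ^ 10, by rw [evenRoot]; ring⟩

theorem evenRoot_sub_two_pow_lt {D : ℕ} (hD : 10000 < evenRoot D) :
    (evenRoot D - 2) ^ 10 < D := by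
  classical
  have h := Nat.find_min (exists_le_two_mul_pow D)
    (m := Nat.find (exists_le_two_mul_pow D) - 1)
  rw [evenRoot] at hD ⊢
  have h' := h (by omega)
  rw [not_and, not_le] at h'
  rw [← Nat.mul_sub_one 2 _]
  exact h' (by omega)

theorem tendsto_evenRoot : Tendsto evenRoot atTop atTop := by
  refine tendsto_atTop.2 fun b => eventually_atTop.2 ⟨b ^ 10 + 1, fun D hD => ?_⟩
  by_contra hb
  have := le_evenRoot_pow D
  have := Nat.pow_le_pow_left (not_le.1 hb).le 10
  omega

/-- The relative excess number of rounds Builder uses for maximum degree at most `D`. -/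
noncomputable def excess (D : ℕ) : ℝ :=
  max 0 (((evenRoot D : ℝ) ^ 10 + 6 * (evenRoot D : ℝ) ^ 9 + 4) / D - 1)

theorem tendsto_excess_bound :
    Tendsto (fun L : ℕ => ((L : ℝ) ^ 10 + 6 * (L : ℝ) ^ 9 + 4) / ((L : ℝ) - 2) ^ 10) atTop
      (nhds 1) := by
  have hc : ContinuousAt (fun e : ℝ => (1 + 6 * e + 4 * e ^ 10) / (1 - 2 * e) ^ 10) 0 :=
    ContinuousAt.div (by fun_prop) (by fun_prop) (by norm_num)
  have h := hc.tendsto.comp (tendsto_const_div_atTop_nhds_zero_nat (1 : ℝ))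
  norm_num at h
  refine h.congr' ?_
  filter_upwards [eventually_gt_atTop 2] with L hL
  have hL' : (2 : ℝ) < L := by exact_mod_cast hL
  have h1 : (L : ℝ) - 2 ≠ 0 := by linarith
  have h2 : (L : ℝ) ≠ 0 := by linarith
  have h3 : 1 - 2 * (L : ℝ)⁻¹ = (L - 2) / L := by field_simp
  simp only [Function.comp_apply, h3, div_pow]
  field_simp

theorem tendsto_excess : Tendsto excess atTop (nhds 0) := by
  have h := (tendsto_const_nhds (x := (0 : ℝ))).max
    ((tendsto_excess_bound.comp tendsto_evenRoot).sub_const 1)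
  rw [sub_self, max_self] at h
  refine squeeze_zero' (Eventually.of_forall fun D => le_max_left _ _) ?_ h
  filter_upwards [tendsto_evenRoot.eventually_gt_atTop 10000] with D hD
  refine max_le_max_left _ (sub_le_sub_right ?_ _)
  have hD' : (10000 : ℝ) < evenRoot D := by exact_mod_cast hD
  have h2 : ((evenRoot D : ℝ) - 2) ^ 10 ≤ D := by
    have := (evenRoot_sub_two_pow_lt hD).le
    rw [← @Nat.cast_le ℝ] at this
    push_cast [show 2 ≤ evenRoot D by omega] at this
    exact this
  have h3 : 0 < (evenRoot D : ℝ) - 2 := by linarith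
  exact div_le_div_of_nonneg_left (by positivity) (by positivity) h2

theorem rounds_le {n D m : ℕ} (hD : 0 < D) (hm : 2 * m = evenRoot D ^ 10) :
    (m + evenRoot D ^ 9) * n + (evenRoot D ^ 9 * n + (evenRoot D ^ 9 * n + 2 * n)) ≤
      ⌈(1 + excess D) * (D : ℝ) * (n : ℝ) / 2⌉₊ := by
  have hD' : (0 : ℝ) < D := by exact_mod_cast hD
  have hm' : 2 * (m : ℝ) = (evenRoot D : ℝ) ^ 10 := by exact_mod_cast hm
  have h : (evenRoot D : ℝ) ^ 10 + 6 * (evenRoot D : ℝ) ^ 9 + 4 ≤ (1 + excess D) * D := by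
    rw [← div_le_iff₀ hD', ← sub_le_iff_le_add']
    exact le_max_right _ _
  rw [← @Nat.cast_le ℝ]
  refine le_trans ?_ (Nat.le_ceil _)
  push_cast
  have := mul_le_mul_of_nonneg_right h (Nat.cast_nonneg (α := ℝ) n)
  rw [← hm'] at this
  linarith

/-- A bound for the probability that Builder fails. -/
noncomputable def failBound (n : ℕ) : ℝ := 1 / √√n + 12 / √n

theorem tendsto_failBound : Tendsto failBound atTop (nhds 0) := by
  have h1 : Tendsto (fun n : ℕ => √(n : ℝ)) atTop atTop :=
    Real.tendsto_sqrt_atTop.comp tendsto_natCast_atTop_atTop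
  have h2 := (tendsto_const_nhds (x := (1 : ℝ))).div_atTop (Real.tendsto_sqrt_atTop.comp h1)
  have h3 := (tendsto_const_nhds (x := (12 : ℝ))).div_atTop h1
  have h := h2.add h3
  rw [add_zero] at h
  exact h

theorem exists_strategy {n : ℕ} (hn : 0 < n) {H : SimpleGraph (Fin n)} {D : ℕ}
    (hdeg : ∀ v, (H.neighborSet v).ncard ≤ D) :
    ∃ σ : StarStrategy n,
      1 - failBound n ≤ starProb n ⌈(1 + excess D) * (D : ℝ) * (n : ℝ) / 2⌉₊ σ H := by
  have hdeg' : ∀ u, (nbrs H u).card ≤ D := fun u => by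
    refine le_of_eq_of_le ?_ (hdeg u)
    rw [← Set.ncard_coe_finset]
    congr 1
    ext v
    simp
  have hfail : 0 ≤ failBound n := by unfold failBound; positivity
  have hwins : Wins H ⌈(1 + excess D) * (D : ℝ) * (n : ℝ) / 2⌉₊ (1 - failBound n) ⊥ := by
    obtain rfl | hD := D.eq_zero_or_pos
    · refine (Wins.of_containsCopy hn ⟨id, Function.injective_id, fun u v huv => ?_⟩ _).mono_prob
        (by linarith)
      have := Finset.card_eq_zero.1 (Nat.le_zero.1 (hdeg' u))
      exact absurd (mem_nbrs.2 huv) (by simp [this])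
    · obtain ⟨m, hm⟩ := exists_two_mul_eq_evenRoot_pow D
      refine Wins.mono_rounds hn (by linarith) (rounds_le hD hm) fun G _ => ?_
      refine (wins_of_degree_le hn (le_evenRoot D) hm
        (fun u => (hdeg' u).trans (le_evenRoot_pow D)) G).mono_prob (le_of_eq ?_)
      unfold failBound
      ring
  obtain ⟨σ, hσ⟩ := hwins
  simp only [bot_sup_eq] at hσ
  exact ⟨σ, by rwa [starProb_eq_offerProb]⟩

end Rounds

theorem semirandom_star_bounded_degree (Δ : ℕ → ℕ) (H : ∀ n, SimpleGraph (Fin n))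
    (hdeg : ∀ n, ∀ v : Fin n, ((H n).neighborSet v).ncard ≤ Δ n) :
    ∃ f : ℕ → ℝ, (∀ D, 0 ≤ f D) ∧ Tendsto f atTop (nhds 0) ∧
      ∃ σ : ∀ n, StarStrategy n,
        Tendsto
          (fun n => starProb n ⌈(1 + f (Δ n)) * (Δ n : ℝ) * (n : ℝ) / 2⌉₊ (σ n) (H n))
          atTop (nhds 1) := by
  refine ⟨excess, fun D => le_max_left _ _, tendsto_excess, ?_⟩
  have hex : ∀ n, ∃ σ : StarStrategy n, 0 < n → 1 - failBound n ≤
      starProb n ⌈(1 + excess (Δ n)) * (Δ n : ℝ) * (n : ℝ) / 2⌉₊ σ (H n) := fun n => by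
    obtain rfl | hn := n.eq_zero_or_pos
    · exact ⟨fun _ _ => none, fun h => absurd h (lt_irrefl 0)⟩
    · obtain ⟨σ, hσ⟩ := exists_strategy hn (hdeg n)
      exact ⟨σ, fun _ => hσ⟩
  choose σ hσ using hex
  refine ⟨σ, ?_⟩
  have hlim : Tendsto (fun n => 1 - failBound n) atTop (nhds 1) := by
    simpa using tendsto_failBound.const_sub 1
  refine tendsto_of_tendsto_of_tendsto_of_le_of_le' hlim tendsto_const_nhds ?_ ?_
  · filter_upwards [eventually_gt_atTop 0] with n hn using hσ n hn
  · filter_upwards [eventually_gt_atTop 0] with n hn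
    rw [starProb_eq_offerProb]
    exact offerProb_le_one hn _ _
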